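/- arXiv:1112.2273 — 2 statements merged into one kernel-verified Lean document; each statement's English description precedes it below -/
import Mathlib

section
/- (Well-Balanced Orientation Theorem, Nash-Williams) Every finite undirected graph H on vertex set V has an orientation D for which λ_D(u,v) ≥ ⌊λ_H(u,v)/2⌋ for all ordered pairs (u,v) ∈ V × V. -/
/-- `D` is an orientation of the undirected graph `H`: each edge of `H` is assigned
exactly one of its two possible directions. -/
def IsOrientation {V : Type*} (H : SimpleGraph V) (D : V → V → Prop) : Prop :=
  ∀ u v : V, (H.Adj u v ↔ (D u v ∨ D v u)) ∧ ¬ (D u v ∧ D v u)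

/-- `l` is the list of arcs of a directed walk from `u` to `v` in the digraph `D`. -/
def IsDiWalk {V : Type*} (D : V → V → Prop) (u v : V) (l : List (V × V)) : Prop :=
  (∀ a ∈ l, D a.1 a.2) ∧ List.Chain' (fun a b : V × V => a.2 = b.1) l ∧
    ((l = [] ∧ u = v) ∨
      ((l.head?).map Prod.fst = some u ∧ (l.getLast?).map Prod.snd = some v))

/-- `λ_D(u,v) ≥ n`: the digraph `D` contains `n` pairwise edge(arc)-disjoint
directed walks from `u` to `v`. -/
def HasDiFlow {V : Type*} (D : V → V → Prop) (u v : V) (n : ℕ) : Prop :=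
  ∃ f : Fin n → List (V × V), (∀ i, IsDiWalk D u v (f i)) ∧
    ∀ i j, i ≠ j → ∀ a, a ∈ f i → a ∉ f j

/-- `λ_H(u,v) ≥ n`: the undirected graph `H` contains `n` pairwise edge-disjoint
walks from `u` to `v`. -/
def HasFlow {V : Type*} (H : SimpleGraph V) (u v : V) (n : ℕ) : Prop :=
  ∃ f : Fin n → H.Walk u v, ∀ i j, i ≠ j → ∀ e, e ∈ (f i).edges → e ∉ (f j).edges

section NW
open Classical

noncomputable def nwInd {V : Type*} (e : V × V) (X : Set V) : ℕ :=
  if (e.1 ∈ X ↔ e.2 ∈ X) then 0 else 1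

noncomputable def nwCut {V : Type*} (E : Multiset (V × V)) (X : Set V) : ℕ :=
  (E.map (fun e => nwInd e X)).sum

variable {V : Type*}

@[simp] lemma nwCut_zero (X : Set V) : nwCut 0 X = 0 := by simp [nwCut]

@[simp] lemma nwCut_cons (e : V × V) (E : Multiset (V × V)) (X : Set V) :
    nwCut (e ::ₘ E) X = nwInd e X + nwCut E X := by simp [nwCut]

@[simp] lemma nwCut_add (E F : Multiset (V × V)) (X : Set V) :
    nwCut (E + F) X = nwCut E X + nwCut F X := by simp [nwCut]

lemma nwCut_map (φ : V → V) (E : Multiset (V × V)) (X : Set V) :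
    nwCut (E.map (Prod.map φ φ)) X = nwCut E (φ ⁻¹' X) := by
  simp [nwCut, nwInd, Multiset.map_map]

lemma nwCut_compl (E : Multiset (V × V)) (X : Set V) : nwCut E Xᶜ = nwCut E X := by
  simp only [nwCut, nwInd, Set.mem_compl_iff, not_iff_not]

lemma nwCut_empty (E : Multiset (V × V)) : nwCut E (∅ : Set V) = 0 := by
  simp [nwCut, nwInd]

lemma nwCut_sub (E : Multiset (V × V)) (X Y : Set V) :
    nwCut E (X ∩ Y) + nwCut E (X ∪ Y) ≤ nwCut E X + nwCut E Y := by
  induction E using Multiset.induction with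
  | empty => simp
  | cons e E ih =>
    have h : nwInd e (X ∩ Y) + nwInd e (X ∪ Y) ≤ nwInd e X + nwInd e Y := by
      by_cases h1 : e.1 ∈ X <;> by_cases h2 : e.2 ∈ X <;> by_cases h3 : e.1 ∈ Y <;>
        by_cases h4 : e.2 ∈ Y <;> simp [nwInd, h1, h2, h3, h4]
    simp only [nwCut_cons]; omega

lemma nwCut_pos (E : Multiset (V × V)) (X Y : Set V) :
    nwCut E (X \ Y) + nwCut E (Y \ X) ≤ nwCut E X + nwCut E Y := by
  have h := nwCut_sub E X Yᶜ
  have h1 : (X ∪ Yᶜ) = (Y \ X)ᶜ := by ext; simp; tauto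
  rw [h1, nwCut_compl, nwCut_compl] at h
  exact h

lemma nwCut_union_le (E : Multiset (V × V)) (X Y : Set V) :
    nwCut E (X ∪ Y) ≤ nwCut E X + nwCut E Y := by
  have := nwCut_sub E X Y; omega

/-- parity for disjoint unions -/
lemma nwCut_par (E : Multiset (V × V)) (X Y : Set V) (hd : Disjoint X Y) :
    nwCut E (X ∪ Y) % 2 = (nwCut E X + nwCut E Y) % 2 := by
  induction E using Multiset.induction with
  | empty => simp
  | cons e E ih =>
    have a1 : e.1 ∈ X → e.1 ∉ Y := fun h => Set.disjoint_left.mp hd h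
    have a2 : e.2 ∈ X → e.2 ∉ Y := fun h => Set.disjoint_left.mp hd h
    have h : nwInd e (X ∪ Y) % 2 = (nwInd e X + nwInd e Y) % 2 := by
      by_cases h1 : e.1 ∈ X <;> by_cases h2 : e.2 ∈ X <;> by_cases h3 : e.1 ∈ Y <;>
        by_cases h4 : e.2 ∈ Y <;> simp_all [nwInd]
    simp only [nwCut_cons]; omega

/-- no nonloop edges inside `I` -/
def NoIn (E : Multiset (V × V)) (I : Set V) : Prop := ∀ e ∈ E, e.1 ∈ I → e.2 ∈ I → e.1 = e.2

lemma NoIn.mono {E : Multiset (V × V)} {I J : Set V} (h : NoIn E I) (hJ : J ⊆ I) : NoIn E J :=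
  fun e he h1 h2 => h e he (hJ h1) (hJ h2)

lemma nwCut_split (E : Multiset (V × V)) (X : Set V) (hX : NoIn E X) (x : V) (hx : x ∈ X) :
    nwCut E X = nwCut E {x} + nwCut E (X \ {x}) := by
  induction E using Multiset.induction with
  | empty => simp
  | cons e E ih =>
    have h0 := hX e (by simp)
    have ih := ih (fun e he => hX e (by simp [he]))
    have h : nwInd e X = nwInd e {x} + nwInd e (X \ {x}) := by
      by_cases h1 : e.1 ∈ X <;> by_cases h2 : e.2 ∈ X <;> by_cases h3 : e.1 = x <;>
        by_cases h4 : e.2 = x <;> simp_all [nwInd]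
    simp only [nwCut_cons]; omega

lemma nwCut_mod (E : Multiset (V × V)) (I J : Set V) (a : V) (hI : NoIn E (insert a I))
    (haI : a ∉ I) (haJ : a ∉ J) (hd : Disjoint J I) :
    nwCut E (J ∪ I) + nwCut E (insert a J) = nwCut E (J ∪ insert a I) + nwCut E J := by
  induction E using Multiset.induction with
  | empty => simp
  | cons e E ih =>
    have h0 := hI e (by simp)
    have ih := ih (fun e he => hI e (by simp [he]))
    have a1 : e.1 ∈ J → e.1 ∉ I := fun h => Set.disjoint_left.mp hd h
    have a2 : e.2 ∈ J → e.2 ∉ I := fun h => Set.disjoint_left.mp hd h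
    have h : nwInd e (J ∪ I) + nwInd e (insert a J) = nwInd e (J ∪ insert a I) + nwInd e J := by
      by_cases h1 : e.1 ∈ I <;> by_cases h2 : e.2 ∈ I <;> by_cases h3 : e.1 = a <;>
        by_cases h4 : e.2 = a <;> by_cases h5 : e.1 ∈ J <;> by_cases h6 : e.2 ∈ J <;>
        simp_all [nwInd]
    simp only [nwCut_cons]; omega

lemma nw_indep (E N : Multiset (V × V)) (J I : Set V) (hfin : I.Finite) (hI : NoIn E I)
    (hd : Disjoint J I) (hJ : ∀ i ∈ I, nwCut E J ≤ nwCut E (insert i J))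
    (hN : ∀ i ∈ I, nwCut N {i} ≤ 1) (hp : ∀ i ∈ I, nwCut N {i} % 2 = nwCut E {i} % 2) :
    nwCut N I + nwCut E J ≤ nwCut E (J ∪ I) := by
  induction I, hfin using Set.Finite.induction_on with
  | empty => simp [nwCut_empty]
  | @insert a I haI hfin ih =>
    have hsub : I ⊆ insert a I := Set.subset_insert a I
    have ih := ih (hI.mono hsub) (hd.mono_right hsub) (fun i hi => hJ i (hsub hi))
      (fun i hi => hN i (hsub hi)) (fun i hi => hp i (hsub hi))
    have ha : a ∈ insert a I := Set.mem_insert a I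
    have haJ : a ∉ J := fun h => Set.disjoint_left.mp hd h ha
    have h1 := nwCut_mod E I J a hI haI haJ (hd.mono_right hsub)
    have h2 := nwCut_union_le N {a} I
    have h3 := nwCut_par E {a} J (by simpa using haJ)
    rw [Set.singleton_union] at h2 h3
    have h4 := hJ a ha
    have h5 := hN a ha
    have h6 := hp a ha
    omega

lemma nw_extract (M : Multiset (V × V)) (v : V) (h : 1 ≤ nwCut M {v}) :
    ∃ x M1, x ≠ v ∧ (M = (x, v) ::ₘ M1 ∨ M = (v, x) ::ₘ M1) := by
  have : ∃ e ∈ M, nwInd e {v} ≠ 0 := by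
    by_contra hc
    push Not at hc
    have : nwCut M {v} = 0 := by
      unfold nwCut
      apply Multiset.sum_eq_zero
      intro x hx
      obtain ⟨e, he, rfl⟩ := Multiset.mem_map.mp hx
      exact hc e he
    omega
  obtain ⟨⟨a, b⟩, he, h1⟩ := this
  obtain ⟨M1, rfl⟩ := Multiset.exists_cons_of_mem he
  by_cases ha : a = v
  · subst ha
    refine ⟨b, M1, ?_, Or.inr rfl⟩
    rintro rfl
    simp [nwInd] at h1
  · by_cases hb : b = v
    · subst hb
      exact ⟨a, M1, ha, Or.inl rfl⟩
    · simp [nwInd, ha, hb] at h1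

lemma nwInd_swap (x y : V) (X : Set V) : nwInd (x, y) X = nwInd (y, x) X := by
  simp [nwInd, iff_comm]

lemma nwInd_tri (x y z : V) (X : Set V) : nwInd (x, z) X ≤ nwInd (x, y) X + nwInd (y, z) X ∧
    nwInd (x, z) X % 2 = (nwInd (x, y) X + nwInd (y, z) X) % 2 := by
  by_cases h1 : x ∈ X <;> by_cases h2 : y ∈ X <;> by_cases h3 : z ∈ X <;> simp [nwInd, h1, h2, h3]

lemma nw_pairing (n : ℕ) : ∀ M : Multiset (V × V), M.card = n → ∃ N : Multiset (V × V),
    (∀ X, nwCut N X ≤ nwCut M X ∧ nwCut N X % 2 = nwCut M X % 2) ∧ ∀ v, nwCut N {v} ≤ 1 := by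
  induction n using Nat.strong_induction_on with
  | _ n ih =>
  intro M hM
  by_cases h : ∀ v, nwCut M {v} ≤ 1
  · exact ⟨M, fun X => ⟨le_rfl, rfl⟩, h⟩
  · push Not at h
    obtain ⟨v, hv⟩ := h
    obtain ⟨x, M1, hx, h1⟩ := nw_extract M v (by omega)
    have e1 : ∀ X, nwCut M X = nwInd (x, v) X + nwCut M1 X := by
      intro X
      rcases h1 with rfl | rfl
      · simp
      · simp [nwInd_swap]
    have c1 : M.card = M1.card + 1 := by rcases h1 with rfl | rfl <;> simp
    have hx1 : nwInd (x, v) {v} = 1 := by simp [nwInd, hx]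
    obtain ⟨z, M2, hz, h2⟩ := nw_extract M1 v (by have := e1 {v}; omega)
    have e2 : ∀ X, nwCut M1 X = nwInd (v, z) X + nwCut M2 X := by
      intro X
      rcases h2 with rfl | rfl
      · simp [nwInd_swap]
      · simp
    have c2 : M1.card = M2.card + 1 := by rcases h2 with rfl | rfl <;> simp
    obtain ⟨N, hN, hN1⟩ := ih (M2.card + 1) (by omega) ((x, z) ::ₘ M2) (by simp)
    refine ⟨N, fun X => ?_, hN1⟩
    have a := hN X
    have b := nwInd_tri x v z X
    rw [nwCut_cons] at a
    have := e1 X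
    have := e2 X
    omega

noncomputable def nwBal (X : Set V) (e : V × V) : ℤ :=
  (if e.1 ∈ X then 1 else 0) - (if e.2 ∈ X then 1 else 0)

def nwSw (a b : V × V) : Prop := b = a ∨ b = a.swap

lemma nw_euler (n : ℕ) : ∀ S : Multiset (V × V), S.card = n → (∀ X, nwCut S X % 2 = 0) →
    ∃ T : Multiset (V × V), Multiset.Rel nwSw S T ∧ ∀ X, (T.map (nwBal X)).sum = 0 := by
  induction n using Nat.strong_induction_on with
  | _ n ih =>
  intro S hS hev
  induction S using Multiset.induction with
  | empty => exact ⟨0, Multiset.Rel.zero, by simp⟩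
  | cons a S0 _ =>
    obtain ⟨x, y⟩ := a
    simp only [Multiset.card_cons] at hS
    by_cases hxy : x = y
    · subst hxy
      obtain ⟨T, hT, hb⟩ := ih S0.card (by omega) S0 rfl (by
        intro X; have := hev X; simpa [nwInd] using this)
      exact ⟨(x, x) ::ₘ T, Multiset.Rel.cons (Or.inl rfl) hT, by
        intro X; simp [hb X, nwBal]⟩
    · have hx1 : nwInd (x, y) {y} = 1 := by simp [nwInd, hxy]
      obtain ⟨z, M2, hz, h2⟩ := nw_extract S0 y (by
        have := hev {y}; rw [nwCut_cons] at this; omega)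
      have e2 : ∀ X, nwCut S0 X = nwInd (y, z) X + nwCut M2 X := by
        intro X
        rcases h2 with rfl | rfl
        · simp [nwInd_swap]
        · simp
      have c2 : S0.card = M2.card + 1 := by rcases h2 with rfl | rfl <;> simp
      obtain ⟨T, hT, hb⟩ := ih (M2.card + 1) (by omega) ((x, z) ::ₘ M2) (by simp) (by
        intro X
        have := hev X
        have := e2 X
        have b := nwInd_tri x y z X
        rw [nwCut_cons] at *
        omega)
      rw [Multiset.rel_cons_left] at hT
      obtain ⟨c, T1, hc, hT1, rfl⟩ := hT
      have key : ∀ p q, nwSw (x, y) p → nwSw (y, z) q →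
          (∀ X, nwBal X p + nwBal X q = nwBal X c) → ∃ T : Multiset (V × V),
            Multiset.Rel nwSw ((x, y) ::ₘ S0) T ∧ ∀ X, (T.map (nwBal X)).sum = 0 := by
        intro p q hp hq hpq
        refine ⟨p ::ₘ q ::ₘ T1, Multiset.Rel.cons hp ?_, ?_⟩
        · rcases h2 with rfl | rfl
          · refine Multiset.Rel.cons ?_ hT1
            rcases hq with rfl | rfl
            · exact Or.inr rfl
            · exact Or.inl rfl
          · exact Multiset.Rel.cons hq hT1
        · intro X
          have := hb X
          have := hpq X
          simp only [Multiset.map_cons, Multiset.sum_cons] at *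
          omega
      rcases hc with rfl | rfl
      · exact key (x, y) (y, z) (Or.inl rfl) (Or.inl rfl) (by intro X; simp [nwBal])
      · exact key (y, x) (z, y) (Or.inr rfl) (Or.inr rfl) (by intro X; simp [nwBal])

/-- decompose a multigraph along `W` -/
lemma nw_decomp (M : Multiset (V × V)) (W : Set V) : ∃ (N : Multiset (V × V)) (P : Multiset V),
    P.card = nwCut M W ∧ (∀ p ∈ P, p ∈ W) ∧ (∀ Z, nwCut N Z = nwCut N (Z ∩ W)) ∧
    ∀ Z, Z ⊆ W → nwCut M Z = nwCut N Z + (P.map (fun p => if p ∈ Z then 1 else 0)).sum := by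
  induction M using Multiset.induction with
  | empty => exact ⟨0, 0, by simp, by simp, by simp, by simp⟩
  | cons e M ih =>
    obtain ⟨N, P, h1, h2, h3, h4⟩ := ih
    obtain ⟨a, b⟩ := e
    by_cases ha : a ∈ W <;> by_cases hb : b ∈ W
    · refine ⟨(a, b) ::ₘ N, P, ?_, h2, ?_, ?_⟩
      · simp [nwInd, ha, hb, h1]
      · intro Z; rw [nwCut_cons, nwCut_cons, h3 Z]; simp [nwInd, ha, hb]
      · intro Z hZ; rw [nwCut_cons, nwCut_cons, h4 Z hZ]; omega
    · refine ⟨N, a ::ₘ P, ?_, ?_, h3, ?_⟩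
      · simp [nwInd, ha, hb, h1]; omega
      · simpa [ha] using h2
      · intro Z hZ
        have : b ∉ Z := fun h => hb (hZ h)
        rw [nwCut_cons, h4 Z hZ]
        by_cases haZ : a ∈ Z <;> simp [nwInd, haZ, this]; omega
    · refine ⟨N, b ::ₘ P, ?_, ?_, h3, ?_⟩
      · simp [nwInd, ha, hb, h1]; omega
      · simpa [hb] using h2
      · intro Z hZ
        have : a ∉ Z := fun h => ha (hZ h)
        rw [nwCut_cons, h4 Z hZ]
        by_cases haZ : b ∈ Z <;> simp [nwInd, haZ, this]; omega
    · refine ⟨N, P, ?_, h2, h3, ?_⟩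
      · simp [nwInd, ha, hb, h1]
      · intro Z hZ
        have h5 : b ∉ Z := fun h => hb (hZ h)
        have h6 : a ∉ Z := fun h => ha (hZ h)
        rw [nwCut_cons, h4 Z hZ]; simp [nwInd, h5, h6]

def nwConn (E : Multiset (V × V)) (x y : V) (m : ℕ) : Prop :=
  ∀ Z : Set V, x ∈ Z → y ∉ Z → m ≤ nwCut E Z

lemma nwConn.symm {E : Multiset (V × V)} {x y : V} {m : ℕ} (h : nwConn E x y m) :
    nwConn E y x m := by
  intro Z h1 h2
  rw [← nwCut_compl]
  exact h Zᶜ h2 (by simpa using h1)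

lemma nwConn.mono {E : Multiset (V × V)} {x y : V} {m k : ℕ} (h : nwConn E x y m) (hk : k ≤ m) :
    nwConn E x y k := fun Z h1 h2 => hk.trans (h Z h1 h2)

def nwDem (E : Multiset (V × V)) (U X : Set V) (n : ℕ) : Prop :=
  n = 0 ∨ ∃ x ∈ U, ∃ y ∈ U, x ∈ X ∧ y ∉ X ∧ nwConn E x y (2 * n)

lemma nwDem_mk {E : Multiset (V × V)} {U X : Set V} {n : ℕ} {x y : V} (hx : x ∈ U) (hy : y ∈ U)
    (h : nwConn E x y (2 * n)) (hX : ¬ (x ∈ X ↔ y ∈ X)) : nwDem E U X n := by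
  by_cases h1 : x ∈ X
  · exact Or.inr ⟨x, hx, y, hy, h1, by tauto, h⟩
  · exact Or.inr ⟨y, hy, x, hx, by tauto, h1, h.symm⟩

lemma nwDem_compl {E : Multiset (V × V)} {U X : Set V} {n : ℕ} (h : nwDem E U X n) :
    nwDem E U Xᶜ n := by
  rcases h with h | ⟨x, hx, y, hy, h1, h2, h3⟩
  · exact Or.inl h
  · exact nwDem_mk hx hy h3 (by simp [h1, h2])

def nwOK (E : Multiset (V × V)) (U : Set V) (M : Multiset (V × V)) (X : Set V) : Prop :=
  nwCut M X % 2 = nwCut E X % 2 ∧ ∀ n, nwDem E U X n → nwCut M X + 2 * n ≤ nwCut E X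

lemma nwOK_compl {E : Multiset (V × V)} {U : Set V} {M : Multiset (V × V)} {X : Set V}
    (h : nwOK E U M Xᶜ) : nwOK E U M X := by
  refine ⟨?_, fun n hn => ?_⟩
  · have := h.1
    rwa [nwCut_compl, nwCut_compl] at this
  · have := h.2 n (nwDem_compl hn)
    rwa [nwCut_compl, nwCut_compl] at this

def nwTight (E : Multiset (V × V)) (U X : Set V) : Prop :=
  ∃ n, ∃ x ∈ U, ∃ y ∈ U, x ∈ X ∧ y ∉ X ∧ nwConn E x y (2 * n) ∧ nwCut E X = 2 * n

lemma nwTight_compl {E : Multiset (V × V)} {U X : Set V} (h : nwTight E U X) :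
    nwTight E U Xᶜ := by
  obtain ⟨n, x, hx, y, hy, h1, h2, h3, h4⟩ := h
  exact ⟨n, y, hy, x, hx, h2, by simpa using h1, h3.symm, by rw [nwCut_compl, h4]⟩

noncomputable def nwPhi (W : Set V) (c : V) (v : V) : V := if v ∈ W then v else c

lemma nwPhi_pre (W : Set V) (c : V) (hc : c ∉ W) (Z : Set V) (hZ : Z ⊆ W) :
    nwPhi W c ⁻¹' Z = Z := by
  ext v
  simp only [Set.mem_preimage, nwPhi]
  by_cases hv : v ∈ W
  · simp [hv]
  · simp only [hv, if_false]
    exact ⟨fun h => absurd (hZ h) hc, fun h => absurd (hZ h) hv⟩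

lemma nw_contract (E M : Multiset (V × V)) (U W : Set V) (c : V) (hc : c ∉ W)
    (hM : ∀ X, nwOK (E.map (Prod.map (nwPhi W c) (nwPhi W c))) (nwPhi W c '' U) M X) :
    ∃ N, (∀ Z, Z ⊆ W → nwOK E U N Z) ∧ ∀ v, nwCut N {v} ≤ 1 := by
  obtain ⟨N, hN, hN1⟩ := nw_pairing _ M rfl
  refine ⟨N, fun Z hZ => ?_, hN1⟩
  have h := hM Z
  have hpre := nwPhi_pre W c hc Z hZ
  unfold nwOK at h
  rw [nwCut_map, hpre] at h
  refine ⟨(hN Z).2.trans h.1, fun n hn => le_trans (Nat.add_le_add_right (hN Z).1 _) (h.2 n ?_)⟩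
  rcases hn with rfl | ⟨x, hx, y, hy, h1, h2, h3⟩
  · exact Or.inl rfl
  · refine Or.inr ⟨_, Set.mem_image_of_mem _ hx, _, Set.mem_image_of_mem _ hy, ?_, ?_, ?_⟩
    · change x ∈ nwPhi W c ⁻¹' Z
      rwa [hpre]
    · change y ∉ nwPhi W c ⁻¹' Z
      rwa [hpre]
    · intro Z' h4 h5
      rw [nwCut_map]
      exact h3 _ h4 h5

lemma nw_unc (E : Multiset (V × V)) (U W Y : Set V) (j : ℕ) (x0 y0 : V) (hx0 : x0 ∈ U)
    (hy0 : y0 ∈ U) (hxW : x0 ∈ W) (hyW : y0 ∉ W) (hc : nwConn E x0 y0 (2 * j))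
    (hW : nwCut E W ≤ 2 * j + 1) (n : ℕ) (hn : nwDem E U Y n) :
    (∃ a b, nwDem E U (W ∩ Y) a ∧ nwDem E U (W ∪ Y)ᶜ b ∧ n + j ≤ a + b) ∨
    (∃ a b, nwDem E U (W \ Y) a ∧ nwDem E U (Y \ W) b ∧ n + j ≤ a + b) := by
  rcases hn with rfl | ⟨z, hz, z', hz', h1, h2, h3⟩
  · by_cases hxY : x0 ∈ Y
    · exact Or.inl ⟨j, 0, nwDem_mk hx0 hy0 hc (by simp [*]), Or.inl rfl, by omega⟩
    · exact Or.inr ⟨j, 0, nwDem_mk hx0 hy0 hc (by simp [*]), Or.inl rfl, by omega⟩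
  · by_cases hzW : z ∈ W <;> by_cases hzW' : z' ∈ W
    · by_cases hyY : y0 ∈ Y
      · exact Or.inr ⟨n, j, nwDem_mk hz hz' h3 (by simp [*]),
          nwDem_mk hx0 hy0 hc (by simp [*]), le_rfl⟩
      · exact Or.inl ⟨n, j, nwDem_mk hz hz' h3 (by simp [*]),
          nwDem_mk hx0 hy0 hc (by simp [*]), le_rfl⟩
    · have := h3 W hzW hzW'
      by_cases hxY : x0 ∈ Y
      · exact Or.inl ⟨j, n, nwDem_mk hx0 hy0 hc (by simp [*]),
          nwDem_mk hz hz' h3 (by simp [*]), by omega⟩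
      · by_cases hyY : y0 ∈ Y
        · exact Or.inr ⟨j, j, nwDem_mk hx0 hy0 hc (by simp [*]),
            nwDem_mk hx0 hy0 hc (by simp [*]), by omega⟩
        · exact Or.inl ⟨n, j, nwDem_mk hz hz' h3 (by simp [*]),
            nwDem_mk hx0 hy0 hc (by simp [*]), by omega⟩
    · have := h3.symm W hzW' hzW
      by_cases hxY : x0 ∈ Y
      · by_cases hyY : y0 ∈ Y
        · exact Or.inr ⟨n, j, nwDem_mk hz hz' h3 (by simp [*]),
            nwDem_mk hx0 hy0 hc (by simp [*]), by omega⟩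
        · exact Or.inl ⟨j, j, nwDem_mk hx0 hy0 hc (by simp [*]),
            nwDem_mk hx0 hy0 hc (by simp [*]), by omega⟩
      · exact Or.inr ⟨j, n, nwDem_mk hx0 hy0 hc (by simp [*]),
          nwDem_mk hz hz' h3 (by simp [*]), by omega⟩
    · by_cases hxY : x0 ∈ Y
      · exact Or.inl ⟨j, n, nwDem_mk hx0 hy0 hc (by simp [*]),
          nwDem_mk hz hz' h3 (by simp [*]), by omega⟩
      · exact Or.inr ⟨j, n, nwDem_mk hx0 hy0 hc (by simp [*]),
          nwDem_mk hz hz' h3 (by simp [*]), by omega⟩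

lemma nwCut_four (E : Multiset (V × V)) (W Y : Set V) :
    nwCut E (W ∩ Y) + nwCut E (W ∪ Y)ᶜ ≤ nwCut E W + nwCut E Y ∧
    nwCut E (W \ Y) + nwCut E (Y \ W) ≤ nwCut E W + nwCut E Y ∧
    nwCut E Y % 2 = (nwCut E (W ∩ Y) + nwCut E (Y \ W)) % 2 := by
  refine ⟨?_, nwCut_pos E W Y, ?_⟩
  · rw [nwCut_compl]; exact nwCut_sub E W Y
  · rw [← nwCut_par]
    · congr 2; ext v; simp; tauto
    · rw [Set.disjoint_left]; intro v; simp; tauto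

/-- the decomposition in usable form -/
lemma nw_decomp' (M : Multiset (V × V)) (W : Set V) : ∃ (N : Multiset (V × V)) (P : Multiset V),
    P.card = nwCut M W ∧ (∀ p ∈ P, p ∈ W) ∧ 
    ∀ Y, nwCut M (W ∩ Y) = nwCut N Y + (P.map (fun p => if p ∈ Y then 1 else 0)).sum ∧
      nwCut M (W \ Y) = nwCut N Y + (P.map (fun p => if p ∈ Y then 0 else 1)).sum := by
  obtain ⟨N, P, h1, h2, h3, h4⟩ := nw_decomp M W
  refine ⟨N, P, h1, h2, fun Y => ⟨?_, ?_⟩⟩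
  · rw [h4 _ Set.inter_subset_left, h3 Y, Set.inter_comm]
    congr 2
    apply Multiset.map_congr rfl
    intro p hp; simp [h2 p hp]
  · rw [h4 _ Set.diff_subset, ← nwCut_compl N Y, h3 Yᶜ]
    congr 2
    · congr 1; ext v; simp; tauto
    · apply Multiset.map_congr rfl
      intro p hp; by_cases h : p ∈ Y <;> simp [h2 p hp, h]

lemma nw_even (E M1 M2 : Multiset (V × V)) (U W : Set V) (ht : nwTight E U W)
    (h1 : ∀ Z, Z ⊆ W → nwOK E U M1 Z) (h2 : ∀ Z, Z ⊆ Wᶜ → nwOK E U M2 Z) :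
    ∃ M, ∀ X, nwOK E U M X := by
  obtain ⟨j, x0, hx0, y0, hy0, hxW, hyW, hc, hW⟩ := ht
  have c1 : nwCut M1 W = 0 := by
    have := (h1 W subset_rfl).2 j (nwDem_mk hx0 hy0 hc (by simp [*])); omega
  have c2 : nwCut M2 Wᶜ = 0 := by
    have := (h2 Wᶜ subset_rfl).2 j (nwDem_mk hx0 hy0 hc (by simp [*]))
    rw [nwCut_compl E] at this; omega
  obtain ⟨N1, P1, d1, -, f1⟩ := nw_decomp' M1 W
  obtain ⟨N2, P2, d2, -, f2⟩ := nw_decomp' M2 Wᶜ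
  rw [c1, Multiset.card_eq_zero] at d1
  rw [c2, Multiset.card_eq_zero] at d2
  subst d1 d2
  refine ⟨N1 + N2, fun Y => ?_⟩
  have g1 := f1 Y
  have g2 := f2 Y
  have s1 : Wᶜ ∩ Y = Y \ W := by ext; simp; tauto
  have s2 : Wᶜ \ Y = (W ∪ Y)ᶜ := by ext; simp
  simp only [Multiset.map_zero, Multiset.sum_zero, add_zero, s1, s2] at g1 g2
  have A := h1 (W ∩ Y) Set.inter_subset_left
  have B := h1 (W \ Y) Set.diff_subset
  have C := h2 (Y \ W) (by rw [← s1]; exact Set.inter_subset_left)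
  have D := h2 (W ∪ Y)ᶜ (by rw [← s2]; exact Set.diff_subset)
  have F := nwCut_four E W Y
  refine ⟨?_, fun n hn => ?_⟩
  · have := A.1
    have := C.1
    rw [nwCut_add]; omega
  · rw [nwCut_add]
    rcases nw_unc E U W Y j x0 y0 hx0 hy0 hxW hyW hc (by omega) n hn with
      ⟨a, b, ha, hb, hab⟩ | ⟨a, b, ha, hb, hab⟩
    · have := A.2 a ha
      have := D.2 b hb
      omega
    · have := B.2 a ha
      have := C.2 b hb
      omega

lemma nw_I [Finite V] (E M1 : Multiset (V × V)) (U W Y : Set V) (hU : NoIn E Uᶜ)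
    (h1 : ∀ Z, Z ⊆ W → nwOK E U M1 Z) (hp : ∀ v, nwCut M1 {v} ≤ 1)
    (hW : ∀ i ∈ W, i ∉ U → nwCut E W ≤ nwCut E (W \ {i})) (hY : ∀ v ∈ W, v ∈ Y → v ∉ U) :
    nwCut M1 (W ∩ Y) + nwCut E (Y \ W) ≤ nwCut E Y := by
  have h := nw_indep E M1 (Y \ W) (W ∩ Y) (Set.toFinite _) 
    (hU.mono (fun v hv => hY v hv.1 hv.2)) (by
      rw [Set.disjoint_left]; intro v; simp; tauto) (by
      intro i hi
      have s := nwCut_sub E (insert i (Y \ W)) Wᶜ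
      have e1 : insert i (Y \ W) ∩ Wᶜ = Y \ W := by
        ext v
        have := hi.1
        simp only [Set.mem_inter_iff, Set.mem_insert_iff, Set.mem_diff, Set.mem_compl_iff]
        constructor
        · rintro ⟨rfl | h, h'⟩
          · exact absurd this h'
          · exact h
        · exact fun h => ⟨Or.inr h, h.2⟩
      have e2 : insert i (Y \ W) ∪ Wᶜ = (W \ {i})ᶜ := by ext v; simp; tauto
      rw [e1, e2, nwCut_compl, nwCut_compl] at s
      have := hW i hi.1 (hY i hi.1 hi.2)
      omega) (fun i _ => hp i) (by
      intro i hi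
      exact (h1 {i} (by simpa using hi.1)).1)
  have e : (Y \ W) ∪ (W ∩ Y) = Y := by ext v; simp; tauto
  rwa [e] at h

lemma nw_odd_aux [Finite V] (E M1 M2 : Multiset (V × V)) (U W Y : Set V) (j : ℕ)
    (hU : NoIn E Uᶜ) (hcut : nwCut E W = 2 * j + 1)
    (hj : ∀ x ∈ U, ∀ y ∈ U, x ≠ y → nwConn E x y (2 * j))
    (h1 : ∀ Z, Z ⊆ W → nwOK E U M1 Z) (h2 : ∀ Z, Z ⊆ Wᶜ → nwOK E U M2 Z)
    (p1 : ∀ v, nwCut M1 {v} ≤ 1) (p2 : ∀ v, nwCut M2 {v} ≤ 1)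
    (w1 : ∀ i ∈ W, i ∉ U → nwCut E W ≤ nwCut E (W \ {i}))
    (w2 : ∀ i ∈ Wᶜ, i ∉ U → nwCut E Wᶜ ≤ nwCut E (Wᶜ \ {i}))
    (m1 m2 : ℕ) (q1 : nwCut M1 (W ∩ Y) = m1 + 1)
    (q3 : nwCut M2 (Y \ W) = m2) (q2 : nwCut M1 (W \ Y) = m1)
    (q4 : nwCut M2 (W ∪ Y)ᶜ = m2 + 1) (n : ℕ) (hn : nwDem E U Y n) :
    m1 + m2 + 1 + 2 * n ≤ nwCut E Y := by
  have s1 : Wᶜ ∩ Y = Y \ W := by ext; simp; tauto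
  have s2 : Wᶜ \ Y = (W ∪ Y)ᶜ := by ext; simp
  have A := h1 (W ∩ Y) Set.inter_subset_left
  have B := h1 (W \ Y) Set.diff_subset
  have C := h2 (Y \ W) (by rw [← s1]; exact Set.inter_subset_left)
  have D := h2 (W ∪ Y)ᶜ (by rw [← s2]; exact Set.diff_subset)
  have F := nwCut_four E W Y
  by_cases hA : ∀ v ∈ W, v ∈ Y → v ∉ U
  · have I := nw_I E M1 U W Y hU h1 p1 w1 hA
    have : nwDem E U (Y \ W) n := by
      rcases hn with rfl | ⟨x, hx, y, hy, a, b, c⟩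
      · exact Or.inl rfl
      · have : x ∉ W := fun h => hA x h a hx
        exact nwDem_mk hx hy c (by simp [*])
    have := C.2 n this
    omega
  · by_cases hD : ∀ v ∈ Wᶜ, v ∈ Yᶜ → v ∉ U
    · have I := nw_I E M2 U Wᶜ Yᶜ hU h2 p2 w2 hD
      have t1 : Wᶜ ∩ Yᶜ = (W ∪ Y)ᶜ := by ext; simp
      have t2 : Yᶜ \ Wᶜ = W \ Y := by ext; simp; tauto
      rw [t1, t2, nwCut_compl E Y] at I
      have : nwDem E U (W \ Y) n := by
        rcases hn with rfl | ⟨x, hx, y, hy, a, b, c⟩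
        · exact Or.inl rfl
        · have : y ∈ W := by
            by_contra h
            exact hD y h b hy
          exact nwDem_mk hx hy c (by simp [*])
      have := B.2 n this
      omega
    · push Not at hA hD
      obtain ⟨a, aW, aY, aU⟩ := hA
      obtain ⟨b, bW, bY, bU⟩ := hD
      simp only [Set.mem_compl_iff] at bW bY
      have hab := hj a aU b bU (by rintro rfl; exact bY aY)
      have DA : nwDem E U (W ∩ Y) j := nwDem_mk aU bU hab (by simp [*])
      have DD : nwDem E U (W ∪ Y)ᶜ j := nwDem_mk aU bU hab (by simp [*])
      have A1 := A.2 j DA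
      have D1 := D.2 j DD
      rcases hn with rfl | ⟨x, hx, y, hy, h3, h4, h5⟩
      · omega
      · by_cases hxW : x ∈ W <;> by_cases hyW : y ∈ W
        · have := A.2 n (nwDem_mk hx hy h5 (by simp [*]))
          omega
        · have := h5 W hxW hyW
          omega
        · have := h5.symm W hyW hxW
          omega
        · have := D.2 n (nwDem_mk hx hy h5 (by simp [*]))
          omega

lemma nw_odd [Finite V] (E M1 M2 : Multiset (V × V)) (U W : Set V) (j : ℕ)
    (hU : NoIn E Uᶜ) (hcut : nwCut E W = 2 * j + 1)
    (hj : ∀ x ∈ U, ∀ y ∈ U, x ≠ y → nwConn E x y (2 * j))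
    (x0 y0 : V) (hx0 : x0 ∈ U) (hy0 : y0 ∈ U) (hxW : x0 ∈ W) (hyW : y0 ∉ W)
    (h1 : ∀ Z, Z ⊆ W → nwOK E U M1 Z) (h2 : ∀ Z, Z ⊆ Wᶜ → nwOK E U M2 Z)
    (p1 : ∀ v, nwCut M1 {v} ≤ 1) (p2 : ∀ v, nwCut M2 {v} ≤ 1)
    (w1 : ∀ i ∈ W, i ∉ U → nwCut E W ≤ nwCut E (W \ {i}))
    (w2 : ∀ i ∈ Wᶜ, i ∉ U → nwCut E Wᶜ ≤ nwCut E (Wᶜ \ {i})) :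
    ∃ M, ∀ X, nwOK E U M X := by
  have hc := hj x0 hx0 y0 hy0 (by rintro rfl; exact hyW hxW)
  have c1 : nwCut M1 W = 1 := by
    have := (h1 W subset_rfl).2 j (nwDem_mk hx0 hy0 hc (by simp [*]))
    have := (h1 W subset_rfl).1
    omega
  have c2 : nwCut M2 Wᶜ = 1 := by
    have := (h2 Wᶜ subset_rfl).2 j (nwDem_mk hx0 hy0 hc (by simp [*]))
    have := (h2 Wᶜ subset_rfl).1
    rw [nwCut_compl E] at *; omega
  obtain ⟨N1, P1, d1, -, f1⟩ := nw_decomp' M1 W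
  obtain ⟨N2, P2, d2, -, f2⟩ := nw_decomp' M2 Wᶜ
  rw [c1, Multiset.card_eq_one] at d1
  rw [c2, Multiset.card_eq_one] at d2
  obtain ⟨p, rfl⟩ := d1
  obtain ⟨q, rfl⟩ := d2
  have main : ∀ Y, p ∈ Y → nwOK E U ((p, q) ::ₘ (N1 + N2)) Y := by
    intro Y hpY
    have g1 := f1 Y
    have g2 := f2 Y
    have s1 : Wᶜ ∩ Y = Y \ W := by ext; simp; tauto
    have s2 : Wᶜ \ Y = (W ∪ Y)ᶜ := by ext; simp
    simp only [Multiset.map_singleton, Multiset.sum_singleton, s1, s2, hpY, if_true] at g1 g2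
    have A := h1 (W ∩ Y) Set.inter_subset_left
    have B := h1 (W \ Y) Set.diff_subset
    have C := h2 (Y \ W) (by rw [← s1]; exact Set.inter_subset_left)
    have D := h2 (W ∪ Y)ᶜ (by rw [← s2]; exact Set.diff_subset)
    have F := nwCut_four E W Y
    have A1 := A.1
    have C1 := C.1
    by_cases hqY : q ∈ Y
    · simp only [hqY, if_true] at g2
      have e : nwCut ((p, q) ::ₘ (N1 + N2)) Y = nwCut N1 Y + nwCut N2 Y := by
        simp [nwInd, hpY, hqY]
      refine ⟨by rw [e]; omega, fun n hn => ?_⟩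
      rw [e]
      rcases nw_unc E U W Y j x0 y0 hx0 hy0 hxW hyW hc (by omega) n hn with
        ⟨a, b, ha, hb, hab⟩ | ⟨a, b, ha, hb, hab⟩
      · have := A.2 a ha
        have := D.2 b hb
        omega
      · have := B.2 a ha
        have := C.2 b hb
        omega
    · simp only [hqY, if_false] at g2
      have e : nwCut ((p, q) ::ₘ (N1 + N2)) Y = nwCut N1 Y + nwCut N2 Y + 1 := by
        simp [nwInd, hpY, hqY]; omega
      refine ⟨by rw [e]; omega, fun n hn => ?_⟩
      rw [e]
      exact nw_odd_aux E M1 M2 U W Y j hU hcut hj h1 h2 p1 p2 w1 w2 _ _ (by omega) (by omega)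
        (by omega) (by omega) n hn
  refine ⟨(p, q) ::ₘ (N1 + N2), fun Y => ?_⟩
  by_cases hpY : p ∈ Y
  · exact main Y hpY
  · exact nwOK_compl (main Yᶜ hpY)

noncomputable def nwNl (E : Multiset (V × V)) : ℕ := E.countP (fun e => e.1 ≠ e.2)

lemma nwNl_map_le (φ : V → V) (E : Multiset (V × V)) :
    nwNl (E.map (Prod.map φ φ)) ≤ nwNl E := by
  induction E using Multiset.induction with
  | empty => simp
  | cons e E ih =>
    simp only [nwNl, Multiset.map_cons, Multiset.countP_cons] at ih ⊢
    have : (if (Prod.map φ φ e).1 ≠ (Prod.map φ φ e).2 then 1 else 0) ≤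
        (if e.1 ≠ e.2 then 1 else 0) := by
      by_cases h : e.1 = e.2 <;> simp [h]
      split_ifs <;> simp
    omega

lemma nwNl_map_lt (W : Set V) (c : V) (E : Multiset (V × V)) (h : ¬ NoIn E Wᶜ) :
    nwNl (E.map (Prod.map (nwPhi W c) (nwPhi W c))) < nwNl E := by
  unfold NoIn at h
  push Not at h
  obtain ⟨e, he, h1, h2, h3⟩ := h
  obtain ⟨E', rfl⟩ := Multiset.exists_cons_of_mem he
  have := nwNl_map_le (nwPhi W c) E'
  simp only [nwNl, Multiset.map_cons, Multiset.countP_cons] at this ⊢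
  simp only [Set.mem_compl_iff] at h1 h2
  simp only [Prod.map, nwPhi, h1, h2, if_false, ne_eq, not_true, h3, not_false_iff, if_true] at this ⊢
  omega

lemma nw_base (E : Multiset (V × V)) (U : Set V) (h : ¬ ∃ x ∈ U, ∃ y ∈ U, x ≠ y) :
    ∃ M, ∀ X, nwOK E U M X := by
  refine ⟨E, fun X => ⟨rfl, fun n hn => ?_⟩⟩
  rcases hn with rfl | ⟨x, hx, y, hy, a, b, c⟩
  · omega
  · exact absurd ⟨x, hx, y, hy, fun h => b (h ▸ a)⟩ h

lemma nw_delete (E : Multiset (V × V)) (U : Set V) (e : V × V)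
    (ht : ∀ X, nwTight (e ::ₘ E) U X → nwInd e X = 0)
    (ih : ∃ M, ∀ X, nwOK E U M X) : ∃ M, ∀ X, nwOK (e ::ₘ E) U M X := by
  obtain ⟨M, hM⟩ := ih
  have hle : ∀ X, nwInd e X ≤ 1 := fun X => by unfold nwInd; split_ifs <;> omega
  refine ⟨e ::ₘ M, fun X => ⟨?_, fun n hn => ?_⟩⟩
  · have := (hM X).1
    simp only [nwCut_cons]; omega
  · have : nwDem E U X n := by
      rcases hn with rfl | ⟨x, hx, y, hy, a, b, c⟩
      · exact Or.inl rfl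
      · refine Or.inr ⟨x, hx, y, hy, a, b, fun Z hZ hZ' => ?_⟩
        have h1 := c Z hZ hZ'
        by_cases h2 : nwCut (e ::ₘ E) Z = 2 * n
        · have := ht Z ⟨n, x, hx, y, hy, hZ, hZ', c, h2⟩
          simp only [nwCut_cons] at h1; omega
        · have := hle Z
          simp only [nwCut_cons] at h1 h2; omega
    have := (hM X).2 n this
    simp only [nwCut_cons]; omega

/-- a trivial tight set reduces to a singleton -/
lemma nw_triv (E : Multiset (V × V)) (U X : Set V) (ht : nwTight E U X) (hX : NoIn E X) :
    ∃ x ∈ U, nwTight E U {x} ∧ nwCut E (X \ {x}) = 0 := by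
  obtain ⟨n, x, hx, y, hy, a, b, c, d⟩ := ht
  have h1 := nwCut_split E X hX x a
  have hxy : y ∉ ({x} : Set V) := by rintro rfl; exact b a
  have h2 := c {x} rfl hxy
  exact ⟨x, hx, ⟨n, x, hx, y, hy, rfl, hxy, c, by omega⟩, by omega⟩

lemma nwInd_eq_zero_of_cut {E : Multiset (V × V)} {X : Set V} (h : nwCut E X = 0) {e : V × V}
    (he : e ∈ E) : nwInd e X = 0 := by
  obtain ⟨E', rfl⟩ := Multiset.exists_cons_of_mem he
  simp only [nwCut_cons] at h; omega

lemma nw_triv_edge (E : Multiset (V × V)) (U X : Set V) (ht : nwTight E U X) (hX : NoIn E X)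
    (e : V × V) (he : e ∈ E) (hc : nwInd e X ≠ 0) :
    ∃ x ∈ U, nwTight E U {x} ∧ (e.1 = x ∨ e.2 = x) := by
  obtain ⟨x, hx, h1, h2⟩ := nw_triv E U X ht hX
  refine ⟨x, hx, h1, ?_⟩
  have h3 := nwInd_eq_zero_of_cut h2 he
  by_contra hcon
  push Not at hcon
  apply hc
  simpa [nwInd, hcon.1, hcon.2] using h3

lemma nw_drop [Finite V] (E : Multiset (V × V)) (U : Set V) (j : ℕ) (s : V) (hs : s ∈ U)
    (hend : ∀ e ∈ E, e.1 ≠ e.2 → ∃ x ∈ U, nwTight E U {x} ∧ (e.1 = x ∨ e.2 = x))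
    (hj : ∀ x ∈ U, ∀ y ∈ U, x ≠ y → nwConn E x y (2 * j))
    (hsn : ∀ y ∈ U, y ≠ s → ¬ nwConn E s y (2 * j + 2))
    (ih : ∃ M, ∀ X, nwOK E (U \ {s}) M X) : ∃ M, ∀ X, nwOK E U M X := by
  obtain ⟨M0, hM0⟩ := ih
  obtain ⟨M, hM1, hM2⟩ := nw_pairing _ M0 rfl
  have hM : ∀ X, nwOK E (U \ {s}) M X := fun X =>
    ⟨(hM1 X).2.trans (hM0 X).1, fun n hn => by
      have := (hM0 X).2 n hn
      have := (hM1 X).1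
      omega⟩
  refine ⟨M, ?_⟩
  -- key: s ∈ X
  have key : ∀ X : Set V, s ∈ X → ∀ y ∈ U, y ∉ X → nwCut M X + 2 * j ≤ nwCut E X := by
    intro X hsX y hy hyX
    have hys : y ≠ s := by rintro rfl; exact hyX hsX
    by_cases hx : ∃ x ∈ U, x ≠ s ∧ x ∈ X
    · obtain ⟨x, hxU, hxs, hxX⟩ := hx
      refine (hM X).2 j (Or.inr ⟨x, ⟨hxU, hxs⟩, y, ⟨hy, hys⟩, hxX, hyX, hj x hxU y hy ?_⟩)
      rintro rfl; exact hyX hxX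
    · push Not at hx
      have hU : X = {s} ∪ (X \ {s}) := by
        ext v; by_cases hv : v = s <;> simp [hv, hsX]
      have hMle := nwCut_union_le M {s} (X \ {s})
      rw [← hU] at hMle
      have hM0' := (hM (X \ {s})).2 0 (Or.inl rfl)
      have hMs := hM2 s
      have hcs : 2 * j ≤ nwCut E {s} := hj s hs y hy hys.symm {s} rfl hys
      by_cases ht : nwTight E U {s}
      · have hcs' : nwCut E {s} = 2 * j := by
          obtain ⟨n, x, hxU, z, hz, a, b, c, d⟩ := ht
          have : x = s := a
          subst this
          have hn : n ≤ j := by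
            by_contra hn
            exact hsn z hz b (c.mono (by omega))
          omega
        have hpar := (hM {s}).1
        have h := nw_indep E M {s} (X \ {s}) (Set.toFinite _) (by
          intro e he h1 h2
          by_contra hne
          obtain ⟨x, hxU, -, h3⟩ := hend e he hne
          rcases h3 with rfl | rfl
          · exact hx _ hxU h1.2 h1.1
          · exact hx _ hxU h2.2 h2.1) (Set.disjoint_sdiff_right) (by
          intro i hi
          rw [hcs']
          refine hj s hs y hy hys.symm _ (by simp) ?_
          simp only [Set.mem_insert_iff, Set.mem_singleton_iff, hys, or_false]
          rintro rfl; exact hyX hi.1) (fun i _ => hM2 i) (fun i _ => (hM {i}).1)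
        rw [← hU] at h
        omega
      · have hne : nwCut E {s} ≠ 2 * j := fun h =>
          ht ⟨j, s, hs, y, hy, rfl, hys, hj s hs y hy hys.symm, h⟩
        have h := nwCut_split E X (by
          intro e he h1 h2
          by_contra hne
          obtain ⟨x, hxU, h4, h3⟩ := hend e he hne
          have : x = s := by
            by_contra hxs
            rcases h3 with rfl | rfl
            · exact hx _ hxU hxs h1
            · exact hx _ hxU hxs h2
          subst this
          exact ht h4) s hsX
        omega
  intro X
  refine ⟨(hM X).1, fun n hn => ?_⟩
  rcases hn with rfl | ⟨x, hx, y, hy, a, b, c⟩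
  · exact (hM X).2 0 (Or.inl rfl)
  · by_cases hxs : x = s
    · subst hxs
      have hn : n ≤ j := by
        by_contra hn
        exact hsn y hy (by rintro rfl; exact b a) (c.mono (by omega))
      have := key X a y hy b
      omega
    · by_cases hys : y = s
      · subst hys
        have hn : n ≤ j := by
          by_contra hn
          exact hsn x hx hxs (c.symm.mono (by omega))
        have := key Xᶜ b x hx (by simpa using a)
        rw [nwCut_compl, nwCut_compl] at this
        omega
      · exact (hM X).2 n (Or.inr ⟨x, ⟨hx, hxs⟩, y, ⟨hy, hys⟩, a, b, c⟩)

lemma nw_step [Finite V] (E : Multiset (V × V)) (U : Set V)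
    (ih1 : ∀ E' : Multiset (V × V), nwNl E' < nwNl E → ∀ U' : Set V, ∃ M, ∀ X, nwOK E' U' M X)
    (ih2 : ∀ U' : Set V, U'.ncard < U.ncard → ∃ M, ∀ X, nwOK E U' M X) :
    ∃ M, ∀ X, nwOK E U M X := by
  by_cases hbase : ∃ x ∈ U, ∃ y ∈ U, x ≠ y
  swap
  · exact nw_base E U hbase
  have hcon : ∀ W : Set V, ∀ c, c ∉ W → ¬ NoIn E Wᶜ →
      ∃ N, (∀ Z, Z ⊆ W → nwOK E U N Z) ∧ ∀ v, nwCut N {v} ≤ 1 := by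
    intro W c hc hn
    obtain ⟨M, hM⟩ := ih1 _ (nwNl_map_lt W c E hn) (nwPhi W c '' U)
    exact nw_contract E M U W c hc hM
  by_cases hA : ∃ W, nwTight E U W ∧ ¬ NoIn E W ∧ ¬ NoIn E Wᶜ
  · obtain ⟨W, ht, h1, h2⟩ := hA
    obtain ⟨n, x, hx, y, hy, a, b, c, d⟩ := id ht
    obtain ⟨M1, hM1, -⟩ := hcon W y b h2
    obtain ⟨M2, hM2, -⟩ := hcon Wᶜ x (by simpa using a) (by rwa [compl_compl])
    exact nw_even E M1 M2 U W ht hM1 hM2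
  push Not at hA
  by_cases hD : ∃ e ∈ E, e.1 ≠ e.2 ∧ ∀ X, nwTight E U X → nwInd e X = 0
  · obtain ⟨e, he, hne, h⟩ := hD
    obtain ⟨E', rfl⟩ := Multiset.exists_cons_of_mem he
    exact nw_delete E' U e h (ih1 E' (by simp [nwNl, hne]) U)
  push Not at hD
  have hend : ∀ e ∈ E, e.1 ≠ e.2 → ∃ x ∈ U, nwTight E U {x} ∧ (e.1 = x ∨ e.2 = x) := by
    intro e he hne
    obtain ⟨X, hX, hc⟩ := hD e he hne
    by_cases hn : NoIn E X
    · exact nw_triv_edge E U X hX hn e he hc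
    · exact nw_triv_edge E U Xᶜ (nwTight_compl hX) (hA X hX hn) e he
        (by simpa only [nwInd, Set.mem_compl_iff, not_iff_not] using hc)
  have hU : NoIn E Uᶜ := by
    intro e he h1 h2
    by_contra hne
    obtain ⟨x, hxU, -, h3⟩ := hend e he hne
    rcases h3 with rfl | rfl
    · exact h1 hxU
    · exact h2 hxU
  obtain ⟨j, hj, hjm⟩ : ∃ j, (∀ x ∈ U, ∀ y ∈ U, x ≠ y → nwConn E x y (2 * j)) ∧
      ¬ (∀ x ∈ U, ∀ y ∈ U, x ≠ y → nwConn E x y (2 * (j + 1))) := by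
    by_contra hcon
    push Not at hcon
    have hall : ∀ j, ∀ x ∈ U, ∀ y ∈ U, x ≠ y → nwConn E x y (2 * j) := by
      intro j
      induction j with
      | zero => intro x _ y _ _ Z _ _; omega
      | succ j ih => exact hcon j ih
    obtain ⟨x, hx, y, hy, hxy⟩ := hbase
    have := hall (nwCut E {x} + 1) x hx y hy hxy {x} rfl hxy.symm
    omega
  by_cases hS : ∃ s ∈ U, ∀ y ∈ U, y ≠ s → ¬ nwConn E s y (2 * j + 2)
  · obtain ⟨s, hs, hsn⟩ := hS
    exact nw_drop E U j s hs hend hj hsn (ih2 _ (Set.ncard_sdiff_singleton_lt_of_mem hs (Set.toFinite _)))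
  push Not at hS
  have hdeg : ∀ s ∈ U, 2 * j + 2 ≤ nwCut E {s} := by
    intro s hs
    obtain ⟨y, hy, hys, h⟩ := hS s hs
    exact h {s} rfl hys
  have hdeg' : ∀ X : Set V, NoIn E X → ∀ s ∈ U, s ∈ X → 2 * j + 2 ≤ nwCut E X := by
    intro X hX s hs hsX
    have := hdeg s hs
    have := nwCut_split E X hX s hsX
    omega
  unfold nwConn at hjm
  push Not at hjm
  obtain ⟨x, hx, y, hy, hxy, W, hxW, hyW, hW⟩ := hjm
  have n1 : ¬ NoIn E W := fun h => by
    have := hdeg' W h x hx hxW; omega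
  have n2 : ¬ NoIn E Wᶜ := fun h => by
    have := hdeg' Wᶜ h y hy hyW
    rw [nwCut_compl] at this; omega
  have hcut : nwCut E W = 2 * j + 1 := by
    have h1 := hj x hx y hy hxy W hxW hyW
    by_contra h2
    exact n2 (hA W ⟨j, x, hx, y, hy, hxW, hyW, hj x hx y hy hxy, by omega⟩ n1)
  have hw : ∀ W' : Set V, ∀ x ∈ U, ∀ y ∈ U, x ∈ W' → y ∉ W' → ¬ NoIn E W'ᶜ →
      nwCut E W' = 2 * j + 1 → ∀ i ∈ W', i ∉ U → nwCut E W' ≤ nwCut E (W' \ {i}) := by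
    intro W' x hx y hy hxW hyW hn hc i hi hiU
    have hxi : x ∈ W' \ {i} := ⟨hxW, by rintro rfl; exact hiU hx⟩
    have hyi : y ∉ W' \ {i} := fun h => hyW h.1
    have hxy : x ≠ y := by rintro rfl; exact hyW hxW
    have h1 := hj x hx y hy hxy _ hxi hyi
    by_contra h2
    have ht : nwTight E U (W' \ {i}) :=
      ⟨j, x, hx, y, hy, hxi, hyi, hj x hx y hy hxy, by omega⟩
    by_cases h3 : NoIn E (W' \ {i})
    · have := hdeg' _ h3 x hx hxi; omega
    · exact hn ((hA _ ht h3).mono (Set.compl_subset_compl.mpr (fun v hv => hv.1)))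
  obtain ⟨M1, hM1, p1⟩ := hcon W y hyW n2
  obtain ⟨M2, hM2, p2⟩ := hcon Wᶜ x (by simpa using hxW) (by rwa [compl_compl])
  exact nw_odd E M1 M2 U W j hU hcut hj x y hx hy hxW hyW hM1 hM2 p1 p2
    (hw W x hx y hy hxW hyW n2 hcut)
    (hw Wᶜ y hy x hx hyW (by simpa using hxW) (by rwa [compl_compl]) (by rwa [nwCut_compl]))

lemma nw_main [Finite V] (E : Multiset (V × V)) (U : Set V) : ∃ M, ∀ X, nwOK E U M X := by
  obtain ⟨a, ha⟩ : ∃ a, nwNl E = a := ⟨_, rfl⟩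
  induction a using Nat.strong_induction_on generalizing E U with
  | _ a iha =>
  obtain ⟨b, hb⟩ : ∃ b, U.ncard = b := ⟨_, rfl⟩
  induction b using Nat.strong_induction_on generalizing U with
  | _ b ihb =>
  exact nw_step E U (fun E' h U' => iha _ (ha ▸ h) E' U' rfl) (fun U' h => ihb _ (hb ▸ h) U' rfl)

def nwWalk (F : Finset (V × V)) : V → V → List (V × V) → Prop
  | u, v, [] => u = v
  | u, v, a :: l => a ∈ F ∧ a.1 = u ∧ nwWalk F a.2 v l

lemma nwWalk_append {F : Finset (V × V)} {u v : V} {l1 l2 : List (V × V)} :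
    nwWalk F u v (l1 ++ l2) ↔ ∃ w, nwWalk F u w l1 ∧ nwWalk F w v l2 := by
  induction l1 generalizing u with
  | nil => simp [nwWalk]
  | cons a l ih => simp [nwWalk, ih, and_assoc]

lemma nwWalk_nodup {F : Finset (V × V)} {u v : V} {l : List (V × V)} (h : nwWalk F u v l) :
    ∃ l', nwWalk F u v l' ∧ l'.Nodup := by
  induction l generalizing u with
  | nil => exact ⟨[], h, List.nodup_nil⟩
  | cons a l ih =>
    obtain ⟨h1, h2, h3⟩ := h
    obtain ⟨l', h4, h5⟩ := ih h3
    by_cases ha : a ∈ l'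
    · obtain ⟨s, t, rfl⟩ := List.append_of_mem ha
      obtain ⟨w, -, h6⟩ := nwWalk_append.mp h4
      exact ⟨a :: t, ⟨h1, h2, h6.2.2⟩, (List.nodup_append.mp h5).2.1⟩
    · exact ⟨a :: l', ⟨h1, h2, h4⟩, List.nodup_cons.mpr ⟨ha, h5⟩⟩

lemma nwWalk_mem {F : Finset (V × V)} {u v : V} {l : List (V × V)} (h : nwWalk F u v l) :
    ∀ a ∈ l, a ∈ F := by
  induction l generalizing u with
  | nil => simp
  | cons a l ih =>
    intro b hb
    rcases List.mem_cons.mp hb with rfl | hb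
    · exact h.1
    · exact ih h.2.2 b hb

lemma nwWalk_mono {F G : Finset (V × V)} (hFG : F ⊆ G) {u v : V} {l : List (V × V)}
    (h : nwWalk F u v l) : nwWalk G u v l := by
  induction l generalizing u with
  | nil => exact h
  | cons a l ih => exact ⟨hFG h.1, h.2.1, ih h.2.2⟩

lemma nwWalk_bal {F : Finset (V × V)} {u v : V} {l : List (V × V)} (h : nwWalk F u v l)
    (X : Set V) : (l.map (nwBal X)).sum = nwBal X (u, v) := by
  induction l generalizing u with
  | nil => have : u = v := h; subst this; simp [nwBal]
  | cons a l ih =>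
    obtain ⟨h1, rfl, h3⟩ := h
    rw [List.map_cons, List.sum_cons, ih h3]
    simp [nwBal]

lemma nwWalk_di {F : Finset (V × V)} {D : V → V → Prop} (hD : ∀ a ∈ F, D a.1 a.2) {u v : V}
    {l : List (V × V)} (h : nwWalk F u v l) : IsDiWalk D u v l := by
  refine ⟨fun a ha => hD a (nwWalk_mem h a ha), ?_, ?_⟩
  · induction l generalizing u with
    | nil => exact List.isChain_nil
    | cons a l ih =>
      have h2 := ih h.2.2
      cases l with
      | nil => exact List.isChain_singleton _
      | cons b l => exact List.isChain_cons_cons.mpr ⟨h.2.2.2.1.symm, h2⟩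
  · cases l with
    | nil => exact Or.inl ⟨rfl, h⟩
    | cons a l =>
      refine Or.inr ⟨by simp [h.2.1], ?_⟩
      induction l generalizing u a with
      | nil => have : a.2 = v := h.2.2
               simp [this]
      | cons b l ih =>
        have := ih b h.2.2
        rw [List.getLast?_cons_cons]; exact this

noncomputable def nwOut (F : Finset (V × V)) (X : Set V) : ℕ :=
  ∑ a ∈ F, if a.1 ∈ X ∧ a.2 ∉ X then 1 else 0

noncomputable def nwG (F : Finset (V × V)) (X : Set V) : ℤ := ∑ a ∈ F, nwBal X a

lemma nwG_le_out (F : Finset (V × V)) (X : Set V) : nwG F X ≤ nwOut F X := by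
  unfold nwG nwOut
  push_cast
  refine Finset.sum_le_sum fun a _ => ?_
  by_cases h1 : a.1 ∈ X <;> by_cases h2 : a.2 ∈ X <;> simp [nwBal, h1, h2]

lemma nw_flow (u v : V) (k : ℕ) : ∀ F : Finset (V × V),
    (∀ X : Set V, u ∈ X → v ∉ X → (k : ℤ) ≤ nwG F X) →
    ∃ f : Fin k → List (V × V), (∀ i, nwWalk F u v (f i)) ∧
      ∀ i j, i ≠ j → ∀ a, a ∈ f i → a ∉ f j := by
  induction k with
  | zero => intro F _; exact ⟨fun _ => [], fun i => i.elim0, fun i => i.elim0⟩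
  | succ k ih =>
    intro F hF
    have hw : ∃ l, nwWalk F u v l := by
      by_contra hcon
      push Not at hcon
      have h1 := hF {x | ∃ l, nwWalk F u x l} ⟨[], rfl⟩ (by simpa using hcon)
      have h2 := nwG_le_out F {x | ∃ l, nwWalk F u x l}
      have h3 : nwOut F {x | ∃ l, nwWalk F u x l} = 0 := by
        unfold nwOut
        refine Finset.sum_eq_zero fun a ha => ?_
        rw [if_neg]
        rintro ⟨⟨l, hl⟩, h⟩
        exact h ⟨l ++ [a], nwWalk_append.mpr ⟨a.1, hl, ha, rfl, rfl⟩⟩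
      rw [h3] at h2
      push_cast at h1 h2
      omega
    obtain ⟨l0, hl0⟩ := hw
    obtain ⟨l, hl, hnd⟩ := nwWalk_nodup hl0
    have hsub : l.toFinset ⊆ F := fun a ha => nwWalk_mem hl a (by simpa using ha)
    obtain ⟨f, hf1, hf2⟩ := ih (F \ l.toFinset) (by
      intro X hu hv
      have h1 := hF X hu hv
      have h2 : nwG (F \ l.toFinset) X + nwG l.toFinset X = nwG F X :=
        Finset.sum_sdiff hsub
      have h3 : nwG l.toFinset X = 1 := by
        unfold nwG
        rw [List.sum_toFinset _ hnd, nwWalk_bal hl X]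
        simp [nwBal, hu, hv]
      push_cast at h1
      omega)
    have hdis : ∀ i, ∀ a, a ∈ f i → a ∉ l := fun i a ha hal => by
      have := nwWalk_mem (hf1 i) a ha
      simp [hal] at this
    refine ⟨Fin.cons l f, fun i => ?_, fun i j => ?_⟩
    · refine Fin.cases ?_ (fun i => ?_) i
      · simpa using hl
      · simpa using nwWalk_mono Finset.sdiff_subset (hf1 i)
    · refine Fin.cases ?_ (fun i => ?_) i <;> refine Fin.cases ?_ (fun j => ?_) j
      · simp
      · intro _ a ha hb
        exact hdis j a (by simpa using hb) (by simpa using ha)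
      · intro _ a ha hb
        exact hdis i a (by simpa using ha) (by simpa using hb)
      · intro hij a ha hb
        exact hf2 i j (fun h => hij (by rw [h])) a (by simpa using ha) (by simpa using hb)

lemma nwOut_sub (F : Finset (V × V)) (X Y : Set V) :
    nwOut F (X ∩ Y) + nwOut F (X ∪ Y) ≤ nwOut F X + nwOut F Y := by
  unfold nwOut
  rw [← Finset.sum_add_distrib, ← Finset.sum_add_distrib]
  refine Finset.sum_le_sum fun e _ => ?_
  by_cases h1 : e.1 ∈ X <;> by_cases h2 : e.2 ∈ X <;> by_cases h3 : e.1 ∈ Y <;>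
        by_cases h4 : e.2 ∈ Y <;> simp [h1, h2, h3, h4]

lemma nwG_sum [Fintype V] (F : Finset (V × V)) (X : Set V) :
    nwG F X = ∑ w : V, if w ∈ X then nwG F {w} else 0 := by
  unfold nwG
  have : ∀ w : V, (if w ∈ X then ∑ a ∈ F, nwBal {w} a else 0) =
      ∑ a ∈ F, if w ∈ X then nwBal {w} a else 0 := by
    intro w; split_ifs <;> simp
  simp_rw [this]
  rw [Finset.sum_comm]
  refine Finset.sum_congr rfl fun a _ => ?_
  have h : ∀ w : V, (if w ∈ X then nwBal {w} a else 0) =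
      (if a.1 = w then (if w ∈ X then 1 else 0) else 0) -
      (if a.2 = w then (if w ∈ X then 1 else 0) else 0) := by
    intro w
    by_cases h1 : w ∈ X <;> simp [nwBal, h1]
  simp_rw [h]
  rw [Finset.sum_sub_distrib]
  simp [nwBal]

lemma nw_min [Finite V] (F : Finset (V × V)) (u v : V) (k : ℕ) (huv : u ≠ v)
    (hF : ∀ X : Set V, u ∈ X → v ∉ X → k ≤ nwOut F X)
    (ht : ∀ a ∈ F, ∃ X : Set V, u ∈ X ∧ v ∉ X ∧ nwOut F X ≤ k ∧ a.1 ∈ X ∧ a.2 ∉ X) :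
    ∀ X : Set V, u ∈ X → v ∉ X → (k : ℤ) ≤ nwG F X := by
  have hu : (k : ℤ) ≤ nwG F {u} := by
    have h1 := hF {u} rfl huv.symm
    have h2 : (nwOut F {u} : ℤ) = nwG F {u} := by
      unfold nwOut nwG
      push_cast
      refine Finset.sum_congr rfl fun a ha => ?_
      obtain ⟨X, hu, -, -, -, h2⟩ := ht a ha
      have : a.2 ≠ u := by rintro h; exact h2 (h ▸ hu)
      simp [nwBal, this]
    omega
  have hw : ∀ w, w ≠ v → 0 ≤ nwG F {w} := by
    intro w hwv
    by_cases hin : ∃ a ∈ F, a.2 = w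
    · obtain ⟨a0, ha0, ha0w⟩ := hin
      obtain ⟨X0, a1, a2, a3, a4, a5⟩ := ht a0 ha0
      obtain ⟨T, hT⟩ := Set.Finite.exists_maximal
        (Set.toFinite {X : Set V | u ∈ X ∧ v ∉ X ∧ nwOut F X ≤ k ∧ w ∉ X})
        ⟨X0, a1, a2, a3, ha0w ▸ a5⟩
      obtain ⟨t1, t2, t3, t4⟩ := hT.1
      have hall : ∀ a ∈ F, a.2 = w → a.1 ∈ T := by
        intro a ha haw
        obtain ⟨Y, b1, b2, b3, b4, b5⟩ := ht a ha
        have hs := nwOut_sub F T Y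
        have h1 := hF (T ∩ Y) ⟨t1, b1⟩ (fun h => t2 h.1)
        have : T ∪ Y ≤ T := hT.2 ⟨Or.inl t1, by simp [t2, b2], by omega, by
          simp [t4, ← haw, b5]; exact haw ▸ t4⟩ Set.subset_union_left
        exact this (Or.inr b4)
      have h1 := hF (insert w T) (Or.inr t1) (by simp [hwv.symm, t2])
      have h2 : (nwOut F (insert w T) : ℤ) ≤ nwOut F T + nwG F {w} := by
        unfold nwOut nwG
        push_cast
        rw [← Finset.sum_add_distrib]
        refine Finset.sum_le_sum fun a ha => ?_
        have h3 := hall a ha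
        by_cases c1 : a.2 = w
        · have h3 := h3 c1
          have : a.1 ≠ w := fun h => t4 (h ▸ h3)
          simp [nwBal, c1, h3, this, t4]
        · by_cases c2 : a.1 = w
          · by_cases c3 : a.2 ∈ T <;> simp [nwBal, c1, c2, t4, c3]
          · simp [nwBal, c1, c2]
      omega
    · push Not at hin
      unfold nwG
      refine Finset.sum_nonneg fun a ha => ?_
      have := hin a ha
      by_cases h : a.1 = w <;> simp [nwBal, this, h]
  intro X huX hvX
  have := Fintype.ofFinite V
  rw [nwG_sum]
  refine hu.trans ?_
  have h := Finset.single_le_sum (f := fun w : V => if w ∈ X then nwG F {w} else 0)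
    (s := Finset.univ) (fun w _ => by
      split_ifs with h
      · exact hw w (by rintro rfl; exact hvX h)
      · exact le_rfl) (Finset.mem_univ u)
  simpa [huX] using h

lemma nw_menger [Finite V] (F : Finset (V × V)) (u v : V) (k : ℕ) (huv : u ≠ v)
    (hF : ∀ X : Set V, u ∈ X → v ∉ X → k ≤ nwOut F X) :
    ∃ f : Fin k → List (V × V), (∀ i, nwWalk F u v (f i)) ∧
      ∀ i j, i ≠ j → ∀ a, a ∈ f i → a ∉ f j := by
  induction hc : F.card using Nat.strong_induction_on generalizing F with
  | _ n ih =>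
  by_cases h : ∃ a ∈ F, ∀ X : Set V, u ∈ X → v ∉ X → k ≤ nwOut (F.erase a) X
  · obtain ⟨a, ha, h⟩ := h
    obtain ⟨f, h1, h2⟩ := ih _ (by rw [← hc]; exact Finset.card_erase_lt_of_mem ha) (F.erase a) h rfl
    exact ⟨f, fun i => nwWalk_mono (Finset.erase_subset _ _) (h1 i), h2⟩
  · push Not at h
    refine nw_flow u v k F (nw_min F u v k huv hF fun a ha => ?_)
    obtain ⟨X, hu, hv, hX⟩ := h a ha
    have h1 := hF X hu hv
    have h2 : nwOut (F.erase a) X + (if a.1 ∈ X ∧ a.2 ∉ X then 1 else 0) = nwOut F X :=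
      Finset.sum_erase_add _ _ ha
    by_cases h3 : a.1 ∈ X ∧ a.2 ∉ X
    · rw [if_pos h3] at h2
      exact ⟨X, hu, hv, by omega, h3⟩
    · rw [if_neg h3] at h2
      omega

lemma nwRel_cut {S T : Multiset (V × V)} (h : Multiset.Rel nwSw S T) (X : Set V) :
    nwCut T X = nwCut S X := by
  induction h with
  | zero => rfl
  | @cons a b as bs hab _ ih =>
    simp only [nwCut_cons, ih]
    rcases hab with rfl | rfl
    · rfl
    · rw [Prod.swap, nwInd_swap]

lemma nwRel_mk {S T : Multiset (V × V)} (h : Multiset.Rel nwSw S T) :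
    T.map (fun a => s(a.1, a.2)) = S.map (fun a => s(a.1, a.2)) := by
  induction h with
  | zero => rfl
  | @cons a b as bs hab _ ih =>
    simp only [Multiset.map_cons, ih]
    rcases hab with rfl | rfl
    · rfl
    · simp [Sym2.eq_swap]

lemma nwBal_le (S : Multiset (V × V)) (X : Set V) : (S.map (nwBal X)).sum ≤ nwCut S X := by
  induction S using Multiset.induction with
  | empty => simp
  | cons e S ih =>
    simp only [Multiset.map_cons, Multiset.sum_cons, nwCut_cons]
    have : nwBal X e ≤ nwInd e X := by
      by_cases h1 : e.1 ∈ X <;> by_cases h2 : e.2 ∈ X <;> simp [nwBal, nwInd, h1, h2]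
    push_cast; omega

lemma nwBal_out (S : Multiset (V × V)) (X : Set V) :
    (S.map (nwBal X)).sum + nwCut S X =
      2 * ((S.map (fun a => if a.1 ∈ X ∧ a.2 ∉ X then 1 else 0)).sum : ℕ) := by
  induction S using Multiset.induction with
  | empty => simp
  | cons e S ih =>
    simp only [Multiset.map_cons, Multiset.sum_cons, nwCut_cons]
    have : nwBal X e + nwInd e X = 2 * ((if e.1 ∈ X ∧ e.2 ∉ X then 1 else 0 : ℕ) : ℤ) := by
      by_cases h1 : e.1 ∈ X <;> by_cases h2 : e.2 ∈ X <;> simp [nwBal, nwInd, h1, h2]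
    push_cast at this ih ⊢; omega

lemma nw_flow_conn [Finite V] (H : SimpleGraph V) (A : Finset (Sym2 V))
    (hA : ∀ e, e ∈ A ↔ e ∈ H.edgeSet) (g : Sym2 V → V × V) (hg : ∀ e, s((g e).1, (g e).2) = e)
    (u v : V) (m : ℕ) (hf : HasFlow H u v m) : nwConn (A.val.map g) u v m := by
  intro Z hu hv
  obtain ⟨f, hf⟩ := hf
  have h1 : ∀ i, ∃ e ∈ (f i).edges, e ∈ A ∧ nwInd (g e) Z = 1 := by
    intro i
    obtain ⟨d, hd, ha, hb⟩ := (f i).exists_boundary_dart Z hu hv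
    refine ⟨d.edge, List.mem_map_of_mem hd, (hA _).mpr d.edge_mem, ?_⟩
    have h2 := hg d.edge
    have h3 : d.edge = s(d.fst, d.snd) := rfl
    rw [h3] at h2 ⊢
    rcases Sym2.eq_iff.mp h2 with ⟨h4, h5⟩ | ⟨h4, h5⟩ <;> simp [nwInd, h4, h5, ha, hb]
  choose e he1 he2 he3 using h1
  have hinj : Function.Injective e := by
    intro i j hij
    by_contra hne
    exact hf i j hne (e i) (he1 i) (hij ▸ he1 j)
  have h4 : nwCut (A.val.map g) Z = ∑ a ∈ A, nwInd (g a) Z := by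
    rw [nwCut, Multiset.map_map]; rfl
  rw [h4]
  calc m = ∑ a ∈ Finset.univ.image e, 1 := by
        simp [Finset.card_image_of_injective _ hinj]
    _ = ∑ a ∈ Finset.univ.image e, nwInd (g a) Z := by
        refine Finset.sum_congr rfl fun a ha => ?_
        obtain ⟨i, -, rfl⟩ := Finset.mem_image.mp ha
        exact (he3 i).symm
    _ ≤ ∑ a ∈ A, nwInd (g a) Z := by
        refine Finset.sum_le_sum_of_subset fun a ha => ?_
        obtain ⟨i, -, rfl⟩ := Finset.mem_image.mp ha
        exact he2 i

lemma nw_final [Finite V] (H : SimpleGraph V) :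
    ∃ D : V → V → Prop, IsOrientation H D ∧
      ∀ (u v : V) (k : ℕ), HasFlow H u v (2 * k) → HasDiFlow D u v k := by
  obtain ⟨A, hA⟩ : ∃ A : Finset (Sym2 V), ∀ e, e ∈ A ↔ e ∈ H.edgeSet :=
    ⟨(Set.toFinite H.edgeSet).toFinset, fun e => by simp⟩
  have hg : ∀ e : Sym2 V, ∃ a : V × V, s(a.1, a.2) = e := by
    intro e
    induction e with
    | _ x y => exact ⟨(x, y), rfl⟩
  choose g hg using hg
  obtain ⟨M, hM⟩ := nw_main (A.val.map g) Set.univ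
  obtain ⟨T, hT, hbal⟩ := nw_euler _ (A.val.map g + M) rfl (by
    intro X
    have := (hM X).1
    rw [nwCut_add]; omega)
  obtain ⟨E', M', hE', hM', rfl⟩ := Multiset.rel_add_left.mp hT
  have hmk : E'.map (fun a => s(a.1, a.2)) = A.val := by
    rw [nwRel_mk hE', Multiset.map_map]
    simp [Function.comp_def, hg]
  have hnd : (E'.map (fun a => s(a.1, a.2))).Nodup := hmk ▸ A.nodup
  have hEnd : E'.Nodup := Multiset.Nodup.of_map _ hnd
  have hadj : ∀ x y, H.Adj x y ↔ ((x, y) ∈ E' ∨ (y, x) ∈ E') := by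
    intro x y
    rw [← SimpleGraph.mem_edgeSet, ← hA, ← Finset.mem_val, ← hmk, Multiset.mem_map]
    constructor
    · rintro ⟨⟨a, b⟩, h1, h2⟩
      rcases Sym2.eq_iff.mp h2 with ⟨h4, h5⟩ | ⟨h4, h5⟩
      · simp only at h4 h5; subst h4 h5; exact Or.inl h1
      · simp only at h4 h5; subst h4 h5; exact Or.inr h1
    · rintro (h | h)
      · exact ⟨_, h, rfl⟩
      · exact ⟨_, h, Sym2.eq_swap⟩
  refine ⟨fun x y => (x, y) ∈ E', fun x y => ⟨hadj x y, ?_⟩, ?_⟩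
  · rintro ⟨h1, h2⟩
    have := Multiset.inj_on_of_nodup_map hnd _ h1 _ h2 Sym2.eq_swap
    have hxy : x = y := congrArg Prod.fst this
    subst hxy
    exact H.loopless.irrefl x ((hadj x x).mpr (Or.inl h1))
  · intro u v k hf
    by_cases huv : u = v
    · subst huv
      exact ⟨fun _ => [], fun _ => nwWalk_di (F := ∅) (by simp) rfl, by simp⟩
    have hconn := nw_flow_conn H A hA g hg u v _ hf
    obtain ⟨f, hf1, hf2⟩ := nw_menger ⟨E', hEnd⟩ u v k huv (by
      intro X hu hv
      have h1 := (hM X).2 k (Or.inr ⟨u, trivial, v, trivial, hu, hv, hconn⟩)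
      have h2 := hbal X
      rw [Multiset.map_add, Multiset.sum_add] at h2
      have h3 := nwBal_le M' X
      have h4 := nwBal_out E' X
      rw [nwRel_cut hM'] at h3
      rw [nwRel_cut hE'] at h4
      have h5 : nwOut ⟨E', hEnd⟩ X =
        (E'.map (fun a => if a.1 ∈ X ∧ a.2 ∉ X then 1 else 0)).sum := rfl
      rw [h5]
      omega)
    exact ⟨f, fun i => nwWalk_di (fun a ha => ha) (hf1 i), hf2⟩

end NW

/-- Nash-Williams: every finite graph `H` has an orientation `D` with
`λ_D(u,v) ≥ ⌊λ_H(u,v)/2⌋` for all ordered pairs `(u,v)`, stated as: whenever `H` has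
`2k` pairwise edge-disjoint `u`–`v` walks, `D` has `k` pairwise arc-disjoint ones. -/
theorem well_balanced_orientation
    {V : Type*} [Fintype V] (H : SimpleGraph V) :
    ∃ D : V → V → Prop, IsOrientation H D ∧
      ∀ (u v : V) (k : ℕ), HasFlow H u v (2 * k) → HasDiFlow D u v k := by
  exact nw_final H
end

section
/- Let H be a finite undirected graph on vertex set V and let r : V × V → ℕ be a demand function such that λ_H(u,v) ≥ r(u,v) + r(v,u) for all u, v ∈ V. Then H has an orientation D such that λ_D(u,v) ≥ ⌊(r(u,v) + r(v,u))/2⌋ for all ordered pairs (u,v) ∈ V × V. -/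
universe u
namespace NW
open Finset

section basics
variable {V : Type*} [DecidableEq V]

/-- indicator that `e` crosses `X` -/
def ind (X : Finset V) : Sym2 V → ℕ :=
  Sym2.lift ⟨fun a b => if (a ∈ X ↔ b ∈ X) then 0 else 1, by
    intro a b; simp only [iff_comm]⟩

theorem ind_mk (X : Finset V) (a b : V) :
    ind X s(a, b) = if (a ∈ X ↔ b ∈ X) then 0 else 1 := rfl

def d (E : Multiset (Sym2 V)) (X : Finset V) : ℕ := (E.map (ind X)).sum

theorem d_zero (X : Finset V) : d 0 X = 0 := rfl
theorem d_cons (e : Sym2 V) (E : Multiset (Sym2 V)) (X : Finset V) :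
    d (e ::ₘ E) X = ind X e + d E X := by simp [d]
theorem d_add (E F : Multiset (Sym2 V)) (X : Finset V) :
    d (E + F) X = d E X + d F X := by simp [d]

theorem ind_le_one (X : Finset V) (e : Sym2 V) : ind X e ≤ 1 := by
  induction e using Sym2.ind with | _ a b => rw [ind_mk]; split_ifs <;> omega

theorem d_le1 {E : Multiset (Sym2 V)} {A B : Finset V}
    (h : ∀ e ∈ E, ind A e ≤ ind B e) : d E A ≤ d E B :=
  Multiset.sum_map_le_sum_map _ _ h

theorem d_le2 {E : Multiset (Sym2 V)} {A B C D : Finset V}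
    (h : ∀ e ∈ E, ind A e + ind B e ≤ ind C e + ind D e) :
    d E A + d E B ≤ d E C + d E D := by
  have := Multiset.sum_map_le_sum_map _ _ h
  simpa [d, Multiset.sum_map_add] using this

theorem d_submod (E : Multiset (Sym2 V)) (A B : Finset V) :
    d E (A ∩ B) + d E (A ∪ B) ≤ d E A + d E B := by
  apply d_le2
  intro e _
  induction e using Sym2.ind with | _ a b =>
    simp only [ind_mk, mem_inter, mem_union]; grind

theorem d_posi (E : Multiset (Sym2 V)) (A B : Finset V) :
    d E (A \ B) + d E (B \ A) ≤ d E A + d E B := by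
  apply d_le2
  intro e _
  induction e using Sym2.ind with | _ a b =>
    simp only [ind_mk, mem_sdiff]; grind

theorem d_union_le (E : Multiset (Sym2 V)) (A B : Finset V) :
    d E (A ∪ B) ≤ d E A + d E B := by
  have := d_submod E A B; omega

theorem d_compl [Fintype V] (E : Multiset (Sym2 V)) (A : Finset V) : d E Aᶜ = d E A := by
  unfold d
  congr 1
  apply Multiset.map_congr rfl
  intro e _
  induction e using Sym2.ind with | _ a b =>
    simp only [ind_mk, mem_compl]; grind

theorem d_empty (E : Multiset (Sym2 V)) : d E ∅ = 0 := by
  induction E using Multiset.induction with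
  | empty => rfl
  | cons e E ih => 
    rw [d_cons, ih]
    induction e using Sym2.ind with | _ a b => simp [ind_mk]

theorem d_parity_insert (E : Multiset (Sym2 V)) (A : Finset V) (v : V) (hv : v ∉ A) :
    (d E (insert v A) + d E A + d E {v}) % 2 = 0 := by
  induction E using Multiset.induction with
  | empty => rfl
  | cons e E ih => 
    simp only [d_cons]
    have : (ind (insert v A) e + ind A e + ind {v} e) % 2 = 0 := by
      induction e using Sym2.ind with | _ a b => 
        simp only [ind_mk, mem_insert, mem_singleton]; grind
    omega

theorem d_parity_congr {E M : Multiset (Sym2 V)} (h : ∀ v, d M {v} % 2 = d E {v} % 2)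
    (X : Finset V) : d M X % 2 = d E X % 2 := by
  induction X using Finset.induction with
  | empty => simp [d_empty]
  | insert v X hv ih =>
    have h1 := d_parity_insert E X v hv
    have h2 := d_parity_insert M X v hv
    have := h v
    omega

theorem d_pos_of_mem {E : Multiset (Sym2 V)} {e : Sym2 V} (he : e ∈ E) (X : Finset V) :
    ind X e ≤ d E X := by
  obtain ⟨F, rfl⟩ := Multiset.exists_cons_of_mem he
  rw [d_cons]; omega

theorem exists_of_d_pos {E : Multiset (Sym2 V)} {X : Finset V} (h : 0 < d E X) :
    ∃ e ∈ E, ind X e = 1 := by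
  by_contra hc
  push Not at hc
  have : d E X = 0 := by
    unfold d
    rw [Multiset.sum_eq_zero]
    intro x hx
    obtain ⟨e, he, rfl⟩ := Multiset.mem_map.1 hx
    have := hc e he
    have := ind_le_one X e
    omega
  omega

theorem ind_one_iff {X : Finset V} {e : Sym2 V} :
    ind X e = 1 ↔ ∃ a b, a ∈ X ∧ b ∉ X ∧ e = s(a, b) := by
  induction e using Sym2.ind with | _ a b =>
  rw [ind_mk]
  constructor
  · intro h
    by_cases ha : a ∈ X
    · exact ⟨a, b, ha, by grind, rfl⟩
    · exact ⟨b, a, by grind, ha, Sym2.eq_swap⟩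
  · rintro ⟨x, y, hx, hy, h⟩
    rw [Sym2.eq_iff] at h
    grind

theorem ind_split (X : Finset V) (s u v : V) :
    ind X s(u, v) ≤ ind X s(s, u) + ind X s(s, v) ∧
    (ind X s(u, v) + ind X s(s, u) + ind X s(s, v)) % 2 = 0 := by
  simp only [ind_mk]; grind

theorem ind_single_exists {v : V} {e : Sym2 V} (h : ind {v} e = 1) :
    ∃ a, a ≠ v ∧ e = s(v, a) := by
  obtain ⟨a, b, ha, hb, rfl⟩ := ind_one_iff.1 h
  simp at ha hb; subst ha
  exact ⟨b, hb, rfl⟩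

/-- two edges at a vertex of degree at least two -/
theorem two_edges {E : Multiset (Sym2 V)} {v : V} (h : 2 ≤ d E {v}) :
    ∃ a b F, a ≠ v ∧ b ≠ v ∧ E = s(v, a) ::ₘ s(v, b) ::ₘ F := by
  obtain ⟨e, he, h1⟩ := exists_of_d_pos (E := E) (X := {v}) (by omega)
  obtain ⟨F, rfl⟩ := Multiset.exists_cons_of_mem he
  rw [d_cons] at h
  obtain ⟨e', he', h1'⟩ := exists_of_d_pos (E := F) (X := {v}) (by omega)
  obtain ⟨F', rfl⟩ := Multiset.exists_cons_of_mem he'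
  obtain ⟨a, ha, rfl⟩ := ind_single_exists h1
  obtain ⟨b, hb, rfl⟩ := ind_single_exists h1'
  exact ⟨a, b, F', ha, hb, rfl⟩

theorem normalize (n : ℕ) : ∀ (M : Multiset (Sym2 V)), M.card ≤ n → 
    ∃ M' : Multiset (Sym2 V), (∀ X, d M' X ≤ d M X) ∧ (∀ v, d M' {v} % 2 = d M {v} % 2) ∧
      ∀ v, d M' {v} ≤ 1 := by
  induction n with
  | zero =>
    intro M hM
    have : M = 0 := by simpa using hM
    subst this
    exact ⟨0, fun _ => le_rfl, fun _ => rfl, fun _ => by simp [d_zero]⟩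
  | succ n ih =>
    intro M hM
    by_cases h : ∀ v, d M {v} ≤ 1
    · exact ⟨M, fun _ => le_rfl, fun _ => rfl, h⟩
    · push Not at h
      obtain ⟨v, hv⟩ := h
      obtain ⟨a, b, F, ha, hb, rfl⟩ := two_edges (E := M) (v := v) hv
      obtain ⟨M', h1, h2, h3⟩ := ih (s(a, b) ::ₘ F) (by simp at hM ⊢; omega)
      refine ⟨M', fun X => (h1 X).trans ?_, fun w => (h2 w).trans ?_, h3⟩
      · simp only [d_cons]
        have := (ind_split X v a b).1
        omega
      · simp only [d_cons]
        have := (ind_split {w} v a b).2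
        omega

theorem d_le_sum (M : Multiset (Sym2 V)) (X : Finset V) : d M X ≤ ∑ v ∈ X, d M {v} := by
  induction X using Finset.induction with
  | empty => simp [d_empty]
  | insert v X hv ih =>
    rw [sum_insert hv, insert_eq]
    have := d_union_le M {v} X
    omega

theorem d_map {W : Type*} [DecidableEq W] [Fintype V] (f : V → W) (E : Multiset (Sym2 V)) (X : Finset W) :
    d (E.map (Sym2.map f)) X = d E (univ.filter (fun v => f v ∈ X)) := by
  unfold d
  rw [Multiset.map_map]
  congr 1
  apply Multiset.map_congr rfl
  intro e _
  induction e using Sym2.ind with | _ a b =>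
    simp [ind_mk]

end basics

section conn
variable {V : Type*} [DecidableEq V] [Fintype V]

def Rs (l : V → V → ℕ) (X : Finset V) : ℕ :=
  (univ.filter (fun p : V × V => p.1 ∈ X ∧ p.2 ∉ X)).sup (fun p => l p.1 p.2)

theorem le_Rs {l : V → V → ℕ} {X : Finset V} {x y : V} (hx : x ∈ X) (hy : y ∉ X) :
    l x y ≤ Rs l X :=
  Finset.le_sup (f := fun p : V × V => l p.1 p.2) (b := (x, y)) (by simp [hx, hy])

theorem Rs_le {l : V → V → ℕ} {X : Finset V} {c : ℕ} (h : ∀ x ∈ X, ∀ y ∉ X, l x y ≤ c) :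
    Rs l X ≤ c := by
  apply Finset.sup_le
  rintro ⟨x, y⟩ hp
  simp at hp
  exact h x hp.1 y hp.2

theorem exists_Rs (l : V → V → ℕ) {X : Finset V} {a b : V} (ha : a ∈ X) (hb : b ∉ X) :
    ∃ x ∈ X, ∃ y ∉ X, Rs l X = l x y := by
  obtain ⟨p, hp, h⟩ := Finset.exists_mem_eq_sup (univ.filter (fun p : V × V => p.1 ∈ X ∧ p.2 ∉ X))
    ⟨(a, b), by simp [ha, hb]⟩ (fun p => l p.1 p.2)
  simp at hp
  exact ⟨p.1, hp.1, p.2, hp.2, h⟩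

theorem exists_Rs_pos (l : V → V → ℕ) {X : Finset V} (h : 0 < Rs l X) :
    ∃ x ∈ X, ∃ y ∉ X, Rs l X = l x y := by
  by_contra hc
  by_cases h1 : ∃ a b, a ∈ X ∧ b ∉ X
  · obtain ⟨a, b, ha, hb⟩ := h1
    exact hc (exists_Rs l ha hb)
  · push Not at h1
    have : Rs l X ≤ 0 := Rs_le (fun x hx y hy => absurd (h1 x y hx) hy)
    omega

theorem Rs_compl {l : V → V → ℕ} (hl : ∀ x y, l x y = l y x) (X : Finset V) :
    Rs l Xᶜ = Rs l X := by
  apply le_antisymm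
  · apply Rs_le
    intro x hx y hy
    rw [hl]; apply le_Rs <;> simp_all
  · apply Rs_le
    intro x hx y hy
    rw [hl]; apply le_Rs <;> simp_all

theorem Rs_skew {l : V → V → ℕ} (hl : ∀ x y, l x y = l y x) (X Y : Finset V) :
    Rs l X + Rs l Y ≤ Rs l (X ∩ Y) + Rs l (X ∪ Y) ∨
    Rs l X + Rs l Y ≤ Rs l (X \ Y) + Rs l (Y \ X) := by
  wlog h : Rs l Y ≤ Rs l X generalizing X Y
  · have := this Y X (by omega)
    rw [inter_comm, union_comm]; omega
  rcases Nat.eq_zero_or_pos (Rs l Y) with h0 | h0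
  · -- both zero or only X
    rcases Nat.eq_zero_or_pos (Rs l X) with h1 | h1
    · left; omega
    · obtain ⟨x, hx, y, hy, e⟩ := exists_Rs_pos l h1
      by_cases hxY : x ∈ Y
      · left
        have : l x y ≤ Rs l (X ∩ Y) := le_Rs (by simp [*]) (by simp [*])
        omega
      · right
        have : l x y ≤ Rs l (X \ Y) := le_Rs (by simp [*]) (by simp [*])
        omega
  obtain ⟨x, hx, x', hx', e⟩ := exists_Rs_pos l (lt_of_lt_of_le h0 h)
  obtain ⟨y, hy, y', hy', e'⟩ := exists_Rs_pos l h0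
  have key : ∀ (Z : Finset V) (a b : V), (a ∈ Z ∧ b ∉ Z ∨ a ∉ Z ∧ b ∈ Z) → l a b ≤ Rs l Z := by
    rintro Z a b (⟨h1, h2⟩ | ⟨h1, h2⟩)
    · exact le_Rs h1 h2
    · rw [hl]; exact le_Rs h2 h1
  have k1 := key (X ∩ Y) x x'
  have k2 := key (X ∪ Y) x x'
  have k3 := key (X \ Y) x x'
  have k4 := key (Y \ X) x x'
  have m1 := key (X ∩ Y) y y'
  have m2 := key (X ∪ Y) y y'
  have m3 := key (X \ Y) y y'
  have m4 := key (Y \ X) y y'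
  simp only [mem_inter, mem_union, mem_sdiff, hx, hx', hy, hy'] at k1 k2 k3 k4 m1 m2 m3 m4
  by_cases a1 : x ∈ Y <;> by_cases a2 : x' ∈ Y <;> by_cases a3 : y ∈ X <;> by_cases a4 : y' ∈ X <;>
    simp [a1, a2, a3, a4] at k1 k2 k3 k4 m1 m2 m3 m4 <;> omega

noncomputable def lam (E : Multiset (Sym2 V)) (x y : V) : ℕ :=
  sInf {n | ∃ X : Finset V, x ∈ X ∧ y ∉ X ∧ d E X = n}

theorem lam_le {E : Multiset (Sym2 V)} {x y : V} {X : Finset V} (hx : x ∈ X) (hy : y ∉ X) :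
    lam E x y ≤ d E X := Nat.sInf_le ⟨X, hx, hy, rfl⟩

theorem lam_att (E : Multiset (Sym2 V)) {x y : V} (h : x ≠ y) :
    ∃ X : Finset V, x ∈ X ∧ y ∉ X ∧ d E X = lam E x y :=
  Nat.sInf_mem (s := {n | ∃ X : Finset V, x ∈ X ∧ y ∉ X ∧ d E X = n})
    ⟨_, {x}, by simp, by simpa using h.symm, rfl⟩

theorem lam_comm (E : Multiset (Sym2 V)) (x y : V) : lam E x y = lam E y x := by
  unfold lam
  congr 1
  ext n
  constructor <;>
  · rintro ⟨X, h1, h2, h3⟩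
    exact ⟨Xᶜ, by simpa using h2, by simpa using h1, by rw [d_compl]; exact h3⟩

noncomputable def rh (E : Multiset (Sym2 V)) (x y : V) : ℕ := 2 * (lam E x y / 2)

theorem rh_comm (E : Multiset (Sym2 V)) (x y : V) : rh E x y = rh E y x := by
  simp [rh, lam_comm E x y]

theorem rh_le {E : Multiset (Sym2 V)} {x y : V} {X : Finset V} (hx : x ∈ X) (hy : y ∉ X) :
    rh E x y ≤ d E X := by
  have := lam_le (E := E) hx hy
  unfold rh; omega

noncomputable def Rh (E : Multiset (Sym2 V)) (X : Finset V) : ℕ := Rs (rh E) X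

theorem Rh_le (E : Multiset (Sym2 V)) (X : Finset V) : Rh E X ≤ d E X :=
  Rs_le (fun _ hx _ hy => rh_le hx hy)

theorem Rh_even (E : Multiset (Sym2 V)) (X : Finset V) : Rh E X % 2 = 0 := by
  rcases Nat.eq_zero_or_pos (Rh E X) with h | h
  · omega
  · obtain ⟨x, _, y, _, e⟩ := exists_Rs_pos _ h
    unfold Rh; rw [e]; unfold rh; omega

theorem Rh_compl (E : Multiset (Sym2 V)) (X : Finset V) : Rh E Xᶜ = Rh E X :=
  Rs_compl (rh_comm E) X

def Feas (E M : Multiset (Sym2 V)) : Prop :=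
  (∀ v, d M {v} % 2 = d E {v} % 2) ∧ ∀ X, d M X + Rh E X ≤ d E X

theorem Feas.norm {E M : Multiset (Sym2 V)} (h : Feas E M) :
    ∃ M', Feas E M' ∧ ∀ v, d M' {v} ≤ 1 := by
  obtain ⟨M', h1, h2, h3⟩ := normalize _ M le_rfl
  exact ⟨M', ⟨fun v => (h2 v).trans (h.1 v), fun X => by have := h1 X; have := h.2 X; omega⟩, h3⟩

end conn
end NW

namespace NW
open Finset

section glue
variable {V : Type u} [DecidableEq V] [Fintype V]

/-- induction hypothesis -/
def IH (V : Type u) [Fintype V] (n : ℕ) : Prop :=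
  ∀ (W : Type u) [Fintype W] [DecidableEq W] (F : Multiset (Sym2 W)),
    Fintype.card W + F.card < Fintype.card V + n → ∃ M, Feas F M

theorem half_glue (E : Multiset (Sym2 V)) (ih : IH V E.card) (Z : Finset V)
    (hZ : 2 ≤ (Zᶜ).card) (w0 : V) (hw : w0 ∉ Z) :
    ∃ N : Multiset (Sym2 V), (∀ v ∈ Z, d N {v} % 2 = d E {v} % 2) ∧
      (∀ X ⊆ Z, d N X + Rh E X ≤ d E X) ∧
      (∀ e ∈ N, ∀ x ∈ e, x ∈ Z ∨ x = w0) := by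
  let π : V → Option Z := fun v => if h : v ∈ Z then some ⟨v, h⟩ else none
  let g : Option Z → V := fun o => o.elim w0 (fun z => z.1)
  have hc : Fintype.card (Option Z) + (E.map (Sym2.map π)).card < Fintype.card V + E.card := by
    have := card_add_card_compl Z
    simp
    omega
  obtain ⟨M, hM1, hM2⟩ := ih (Option Z) (E.map (Sym2.map π)) hc
  have hg : ∀ v ∈ Z, g (π v) = v := by
    intro v hv; simp [π, g, hv]
  have hg' : ∀ v ∉ Z, g (π v) = w0 := by
    intro v hv; simp [π, g, hv]
  have hpre : ∀ X ⊆ Z, univ.filter (fun v => π v ∈ univ.filter (fun o => g o ∈ X)) = X := by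
    intro X hX
    ext v
    simp only [mem_filter, mem_univ, true_and]
    by_cases hv : v ∈ Z
    · rw [hg v hv]
    · rw [hg' v hv]
      exact ⟨fun h => absurd (hX h) hw, fun h => absurd (hX h) hv⟩
  have hlam : ∀ x y, π x ≠ π y → lam E x y ≤ lam (E.map (Sym2.map π)) (π x) (π y) := by
    intro x y hxy
    obtain ⟨X, h1, h2, h3⟩ := lam_att (E.map (Sym2.map π)) hxy
    rw [← h3, d_map]
    apply lam_le <;> simpa
  have hR : ∀ X ⊆ Z, Rh E X ≤ Rh (E.map (Sym2.map π)) (univ.filter (fun o => g o ∈ X)) := by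
    intro X hX
    apply Rs_le
    intro x hx y hy
    have hp := hpre X hX
    have h1 : π x ∈ univ.filter (fun o => g o ∈ X) := by
      have : x ∈ univ.filter (fun v => π v ∈ univ.filter (fun o => g o ∈ X)) := by rw [hp]; exact hx
      simpa using this
    have h2 : π y ∉ univ.filter (fun o => g o ∈ X) := by
      intro h
      apply hy
      rw [← hp]
      simpa using h
    have h3 := hlam x y (fun h => h2 (h ▸ h1))
    refine le_trans ?_ (le_Rs h1 h2)
    unfold rh
    omega
  refine ⟨M.map (Sym2.map g), ?_, ?_, ?_⟩
  · intro v hv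
    rw [d_map]
    have := d_parity_congr hM1 (univ.filter (fun o => g o ∈ ({v} : Finset V)))
    rw [this, d_map, hpre _ (by simpa using hv)]
  · intro X hX
    rw [d_map]
    have := hM2 (univ.filter (fun o => g o ∈ X))
    rw [d_map π E, hpre X hX] at this
    have := hR X hX
    omega
  · intro e he x hx
    obtain ⟨e', he', rfl⟩ := Multiset.mem_map.1 he
    obtain ⟨o, ho, rfl⟩ := Sym2.mem_map.1 hx
    cases o with
    | none => right; rfl
    | some z => left; exact z.2

theorem d_eq_zero_of {E : Multiset (Sym2 V)} {X Z : Finset V} (h : ∀ e ∈ E, ind X e ≤ ind Z e)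
    (h0 : d E Z = 0) : d E X = 0 := by
  have := d_le1 h; omega

theorem glue (E : Multiset (Sym2 V)) (ih : IH V E.card) (Z : Finset V)
    (h1 : 2 ≤ Z.card) (h2 : 2 ≤ (Zᶜ).card) (hd : d E Z ≤ Rh E Z + 1) :
    ∃ M : Multiset (Sym2 V), (∀ v, d M {v} % 2 = d E {v} % 2) ∧ (∀ v, d M {v} ≤ 1) ∧
      ∀ X, (X ⊆ Z ∨ X ⊆ Zᶜ) → d M X + Rh E X ≤ d E X := by
  suffices h : ∃ M : Multiset (Sym2 V), (∀ v, d M {v} % 2 = d E {v} % 2) ∧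
      ∀ X, (X ⊆ Z ∨ X ⊆ Zᶜ) → d M X + Rh E X ≤ d E X by
    obtain ⟨M, a, b⟩ := h
    obtain ⟨M', c1, c2, c3⟩ := normalize _ M le_rfl
    exact ⟨M', fun v => (c2 v).trans (a v), c3, fun X hX => by
      have := b X hX; have := c1 X; omega⟩
  obtain ⟨w0, hw⟩ : (Zᶜ).Nonempty := by rw [← card_pos]; omega
  obtain ⟨z0, hz⟩ : Z.Nonempty := by rw [← card_pos]; omega
  have hw' : w0 ∉ Z := by simpa using hw
  obtain ⟨N1, p1, q1, r1⟩ := half_glue E ih Z h2 w0 hw'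
  obtain ⟨N2, p2, q2, r2⟩ := half_glue E ih Zᶜ (by simpa using h1) z0 (by simpa using hz)
  have e1 := q1 Z subset_rfl
  have e2 := q2 Zᶜ subset_rfl
  rw [d_compl, d_compl, Rh_compl] at e2
  -- per-edge facts
  have f1 : ∀ e ∈ N1, ∀ X ⊆ Zᶜ, ind X e ≤ ind Z e := by
    intro e he X hX
    have := r1 e he
    induction e using Sym2.ind with | _ a b =>
      have ha := this a (by simp)
      have hb := this b (by simp)
      have hXa := @hX a
      have hXb := @hX b
      have hXw := @hX w0
      simp only [ind_mk, mem_compl] at *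
      grind
  have f2 : ∀ e ∈ N2, ∀ X ⊆ Z, ind X e ≤ ind Z e := by
    intro e he X hX
    have := r2 e he
    induction e using Sym2.ind with | _ a b =>
      have ha := this a (by simp)
      have hb := this b (by simp)
      have hXa := @hX a
      have hXb := @hX b
      have hXw := @hX z0
      simp only [ind_mk, mem_compl] at *
      grind
  have par1 : d N1 Z % 2 = d E Z % 2 := by
    clear hd h1 h2 e1 e2 q1 q2 f1 f2 r1 p2 r2 hz hw hw'
    have : ∀ X ⊆ Z, d N1 X % 2 = d E X % 2 := by
      intro X
      induction X using Finset.induction with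
      | empty => simp [d_empty]
      | insert v X hv ih =>
        intro hX
        have a1 := d_parity_insert E X v hv
        have a2 := d_parity_insert N1 X v hv
        have := p1 v (hX (by simp))
        have := ih (fun x hx => hX (by simp [hx]))
        omega
    exact this Z subset_rfl
  have par2 : d N2 Z % 2 = d E Z % 2 := by
    clear hd h1 h2 e1 e2 q1 q2 f1 f2 r1 p1 r2 hz hw hw' par1
    have : ∀ X ⊆ Zᶜ, d N2 X % 2 = d E X % 2 := by
      intro X
      induction X using Finset.induction with
      | empty => simp [d_empty]
      | insert v X hv ih =>
        intro hX
        have a1 := d_parity_insert E X v hv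
        have a2 := d_parity_insert N2 X v hv
        have := p2 v (hX (by simp))
        have := ih (fun x hx => hX (by simp [hx]))
        omega
    have := this Zᶜ subset_rfl
    rwa [d_compl, d_compl] at this
  suffices h : ∃ M : Multiset (Sym2 V), (∀ X ⊆ Z, d M X = d N1 X) ∧ (∀ X ⊆ Zᶜ, d M X = d N2 X) by
    obtain ⟨M, m1, m2⟩ := h
    refine ⟨M, ?_, ?_⟩
    · intro v
      by_cases hv : v ∈ Z
      · rw [m1 _ (by simpa using hv)]; exact p1 v hv
      · rw [m2 _ (by simpa using hv)]; exact p2 v (by simpa using hv)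
    · rintro X (hX | hX)
      · rw [m1 _ hX]; exact q1 X hX
      · rw [m2 _ hX]; exact q2 X hX
  by_cases h0 : d N1 Z = 0
  · have h0' : d N2 Z = 0 := by omega
    refine ⟨N1 + N2, fun X hX => ?_, fun X hX => ?_⟩
    · rw [d_add, d_eq_zero_of (fun e he => f2 e he X hX) h0']; omega
    · rw [d_add, d_eq_zero_of (fun e he => f1 e he X hX) h0]; omega
  · have g1 : d N1 Z = 1 := by omega
    have g2 : d N2 Z = 1 := by omega
    obtain ⟨a, ha, ha1⟩ := exists_of_d_pos (E := N1) (X := Z) (by omega)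
    obtain ⟨b, hb, hb1⟩ := exists_of_d_pos (E := N2) (X := Z) (by omega)
    obtain ⟨N1', rfl⟩ := Multiset.exists_cons_of_mem ha
    obtain ⟨N2', rfl⟩ := Multiset.exists_cons_of_mem hb
    rw [d_cons] at g1 g2
    have g1' : d N1' Z = 0 := by omega
    have g2' : d N2' Z = 0 := by omega
    obtain ⟨x, x', hx, hx', rfl⟩ := ind_one_iff.1 ha1
    obtain ⟨y', y, hy', hy, rfl⟩ := ind_one_iff.1 hb1
    refine ⟨s(x, y) ::ₘ (N1' + N2'), fun X hX => ?_, fun X hX => ?_⟩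
    · rw [d_cons, d_add, d_cons,
        d_eq_zero_of (fun e he => f2 e (Multiset.mem_cons_of_mem he) X hX) g2']
      have : ind X s(x, y) = ind X s(x, x') := by
        have := @hX x'
        have := @hX y
        simp only [ind_mk]; grind
      omega
    · rw [d_cons, d_add, d_cons,
        d_eq_zero_of (fun e he => f1 e (Multiset.mem_cons_of_mem he) X hX) g1']
      have : ind X s(x, y) = ind X s(y', y) := by
        have := @hX x
        have := @hX y'
        simp only [mem_compl] at *
        simp only [ind_mk]; grind
      omega

/-- step 1 -/
theorem step1 (E : Multiset (Sym2 V)) (ih : IH V E.card) (Z : Finset V)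
    (h1 : 2 ≤ Z.card) (h2 : 2 ≤ (Zᶜ).card) (hd : d E Z = Rh E Z) : ∃ M, Feas E M := by
  obtain ⟨M, m1, m2, m3⟩ := glue E ih Z h1 h2 (by omega)
  have m3' : ∀ X, (Zᶜ ⊆ X ∨ Z ⊆ X) → d M X + Rh E X ≤ d E X := by
    intro X hX
    rw [← d_compl M, ← d_compl E, ← Rh_compl]
    apply m3
    rcases hX with h | h
    · left; rw [← compl_compl Z]; exact compl_subset_compl.2 h
    · right; exact compl_subset_compl.2 h
  refine ⟨M, m1, fun Y => ?_⟩
  have z0 : d M Z = 0 := by have := m3 Z (Or.inl subset_rfl); omega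
  have hcross : ∀ e ∈ M, ind Z e = 0 := by
    intro e he
    have := d_pos_of_mem he Z; omega
  rcases Rs_skew (rh_comm E) Z Y with h | h
  · have a1 := m3 (Z ∩ Y) (Or.inl inter_subset_left)
    have a2 := m3' (Z ∪ Y) (Or.inr subset_union_left)
    have a3 := d_submod E Z Y
    have a4 : d M Y + d M Z ≤ d M (Z ∩ Y) + d M (Z ∪ Y) := by
      apply d_le2
      intro e he
      have := hcross e he
      induction e using Sym2.ind with | _ a b =>
        simp only [ind_mk, mem_inter, mem_union] at *; grind
    unfold Rh at *; omega
  · have a1 := m3 (Z \ Y) (Or.inl sdiff_subset)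
    have a2 := m3 (Y \ Z) (Or.inr (by intro x; simp))
    have a3 := d_posi E Z Y
    have a4 : d M Y + d M Z ≤ d M (Z \ Y) + d M (Y \ Z) := by
      apply d_le2
      intro e he
      have := hcross e he
      induction e using Sym2.ind with | _ a b =>
        simp only [ind_mk, mem_sdiff] at *; grind
    unfold Rh at *; omega

/-- no nontrivial tight sets -/
def NT (E : Multiset (Sym2 V)) : Prop := ∀ X : Finset V, 2 ≤ X.card → 2 ≤ (Xᶜ).card → Rh E X < d E X

def Tight (E : Multiset (Sym2 V)) (v : V) : Prop := d E {v} = Rh E {v}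

theorem lam_mono {E E' : Multiset (Sym2 V)} (h : ∀ X, d E' X ≤ d E X) {x y : V} (hxy : x ≠ y) :
    lam E' x y ≤ lam E x y := by
  obtain ⟨X, h1, h2, h3⟩ := lam_att E hxy
  rw [← h3]
  exact (lam_le h1 h2).trans (h X)

theorem Rh_mono_of {E E' : Multiset (Sym2 V)} {X : Finset V}
    (h : ∀ x ∈ X, ∀ y ∉ X, rh E x y ≤ rh E' x y) : Rh E X ≤ Rh E' X :=
  Rs_le (fun x hx y hy => (h x hx y hy).trans (le_Rs hx hy))

theorem NT.single {E : Multiset (Sym2 V)} (nt : NT E) {X : Finset V} {x y : V} (hx : x ∈ X)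
    (hy : y ∉ X) (ht : d E X ≤ Rh E X) :
    (X = {x} ∧ Tight E x) ∨ (Xᶜ = {y} ∧ Tight E y) := by
  by_cases h1 : 2 ≤ X.card
  · by_cases h2 : 2 ≤ (Xᶜ).card
    · have := nt X h1 h2; omega
    · right
      have hy' : y ∈ Xᶜ := by simpa using hy
      have : Xᶜ = {y} := by
        apply (eq_singleton_iff_unique_mem).2 ⟨hy', fun z hz => ?_⟩
        by_contra hne
        exact h2 (one_lt_card.2 ⟨z, hz, y, hy', hne⟩)
      refine ⟨this, ?_⟩
      unfold Tight
      rw [← this, d_compl, Rh_compl]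
      exact le_antisymm ht (Rh_le _ _)
  · left
    have : X = {x} := by
      apply (eq_singleton_iff_unique_mem).2 ⟨hx, fun z hz => ?_⟩
      by_contra hne
      exact h1 (one_lt_card.2 ⟨z, hz, x, hx, hne⟩)
    refine ⟨this, ?_⟩
    unfold Tight
    rw [← this]
    exact le_antisymm ht (Rh_le _ _)

/-- step 2 -/
theorem step2 (E : Multiset (Sym2 V)) (ih : IH V E.card) (nt : NT E) (e : Sym2 V) (he : e ∈ E) :
    (∃ M, Feas E M) ∨ ∃ v, Tight E v ∧ ind {v} e = 1 := by
  obtain ⟨E0, rfl⟩ := Multiset.exists_cons_of_mem he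
  by_cases h : ∀ x y, x ≠ y → rh (e ::ₘ E0) x y ≤ rh E0 x y
  · left
    obtain ⟨M, h1, h2⟩ := ih V E0 (by simp)
    refine ⟨e ::ₘ M, fun v => by simp only [d_cons]; have := h1 v; omega, fun X => ?_⟩
    simp only [d_cons]
    have := h2 X
    have : Rh (e ::ₘ E0) X ≤ Rh E0 X := Rh_mono_of (fun x hx y hy => h x y (by rintro rfl; exact hy hx))
    omega
  · right
    push Not at h
    obtain ⟨x, y, hxy, hlt⟩ := h
    obtain ⟨X, h1, h2, h3⟩ := lam_att E0 hxy
    have h4 := lam_le (E := e ::ₘ E0) h1 h2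
    have h5 := ind_le_one X e
    have h7 : rh (e ::ₘ E0) x y ≤ Rh (e ::ₘ E0) X := le_Rs h1 h2
    have h6 : ind X e = 1 ∧ d (e ::ₘ E0) X ≤ rh (e ::ₘ E0) x y := by
      rw [d_cons] at *
      unfold rh at *
      omega
    rcases nt.single h1 h2 (h6.2.trans h7) with ⟨hX, ht⟩ | ⟨hX, ht⟩
    · exact ⟨x, ht, by rw [← hX]; exact h6.1⟩
    · refine ⟨y, ht, ?_⟩
      rw [← hX]
      have := h6.1
      induction e using Sym2.ind with | _ a b =>
        simp only [ind_mk, mem_compl] at *; grind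

end glue
end NW

namespace NW
open Finset

section split
variable {V : Type u} [DecidableEq V] [Fintype V]

/-- demand off s -/
noncomputable def rhs (E : Multiset (Sym2 V)) (s x y : V) : ℕ := if x = s ∨ y = s then 0 else rh E x y

noncomputable def P (E : Multiset (Sym2 V)) (s : V) (X : Finset V) : ℕ := Rs (rhs E s) X

theorem rhs_comm (E : Multiset (Sym2 V)) (s x y : V) : rhs E s x y = rhs E s y x := by
  unfold rhs
  rw [rh_comm E x y]
  simp only [or_comm]

theorem rhs_le (E : Multiset (Sym2 V)) (s x y : V) : rhs E s x y ≤ rh E x y := by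
  unfold rhs; split_ifs <;> omega

theorem P_le_Rh (E : Multiset (Sym2 V)) (s : V) (X : Finset V) : P E s X ≤ Rh E X :=
  Rs_le (fun _ hx _ hy => (rhs_le E s _ _).trans (le_Rs hx hy))

theorem exists_P_pos {E : Multiset (Sym2 V)} {s : V} {X : Finset V} (h : 0 < P E s X) :
    ∃ x ∈ X, ∃ y ∉ X, x ≠ s ∧ y ≠ s ∧ P E s X = rh E x y := by
  obtain ⟨x, hx, y, hy, e⟩ := exists_Rs_pos _ h
  unfold P at *
  rw [e] at h ⊢
  unfold rhs at h ⊢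
  split_ifs at h ⊢ with h1
  · omega
  · push Not at h1
    exact ⟨x, hx, y, hy, h1.1, h1.2, rfl⟩

theorem rh_le_P {E : Multiset (Sym2 V)} {s : V} {X : Finset V} {x y : V} (hx : x ∈ X) (hy : y ∉ X)
    (hxs : x ≠ s) (hys : y ≠ s) : rh E x y ≤ P E s X := by
  have := le_Rs (l := rhs E s) hx hy
  unfold rhs at this
  simp only [hxs, hys, or_self, if_false] at this
  exact this

theorem P_even (E : Multiset (Sym2 V)) (s : V) (X : Finset V) : P E s X % 2 = 0 := by
  rcases Nat.eq_zero_or_pos (P E s X) with h | h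
  · omega
  · obtain ⟨x, _, y, _, _, _, e⟩ := exists_P_pos h
    rw [e]; unfold rh; omega

theorem P_le_d_insert (E : Multiset (Sym2 V)) (s : V) (X : Finset V) :
    P E s X ≤ d E (insert s X) := by
  rcases Nat.eq_zero_or_pos (P E s X) with h | h
  · omega
  · obtain ⟨x, hx, y, hy, hxs, hys, e⟩ := exists_P_pos h
    rw [e]
    exact rh_le (by simp [hx]) (by simp [hy, hys])

def Dang (E : Multiset (Sym2 V)) (s u : V) (X : Finset V) : Prop :=
  s ∉ X ∧ u ∈ X ∧ d E X ≤ P E s X + 1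

theorem d_le2_strict {E : Multiset (Sym2 V)} {A B C D : Finset V} {e : Sym2 V} (he : e ∈ E)
    (h : ∀ e ∈ E, ind A e + ind B e ≤ ind C e + ind D e)
    (h2 : ind A e + ind B e + 2 ≤ ind C e + ind D e) :
    d E A + d E B + 2 ≤ d E C + d E D := by
  obtain ⟨F, rfl⟩ := Multiset.exists_cons_of_mem he
  have := d_le2 (E := F) (fun e he => h e (Multiset.mem_cons_of_mem he))
  simp only [d_cons]
  omega

theorem dang_insert {E : Multiset (Sym2 V)} {s u : V} {X : Finset V} (hX : Dang E s u X)
    (hk : d E {s} % 2 = 0) : d E X ≤ d E (insert s X) := by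
  have h1 := P_le_d_insert E s X
  have h2 := d_parity_insert E X s hX.1
  have := P_even E s X
  have := hX.2.2
  omega

theorem dang_two {E : Multiset (Sym2 V)} {s u : V} {X Y : Finset V} (hX : Dang E s u X)
    (hY : Dang E s u Y) (hk : d E {s} % 2 = 0) (hsu : s(s, u) ∈ E)
    (hcov : ∀ v, v ≠ s → s(s, v) ∈ E → v ∈ X ∨ v ∈ Y) : False := by
  have h1 := dang_insert hX hk
  have h2 := dang_insert hY hk
  obtain ⟨a1, a2, _⟩ := hX
  obtain ⟨b1, b2, _⟩ := hY
  have : d E (insert s X) + d E (insert s Y) + 2 ≤ d E X + d E Y := by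
    apply d_le2_strict hsu
    · intro e he
      induction e using Sym2.ind with | _ a b =>
        have c1 : a = s → b ≠ s → b ∈ X ∨ b ∈ Y := by
          rintro rfl hb; exact hcov b hb he
        have c2 : b = s → a ≠ s → a ∈ X ∨ a ∈ Y := by
          rintro rfl hb; exact hcov a hb (by rw [Sym2.eq_swap]; exact he)
        simp only [ind_mk, mem_insert]; grind
    · simp only [ind_mk, mem_insert]; grind
  omega

theorem dang_pair {E : Multiset (Sym2 V)} {s u : V} {X Y : Finset V} (nt : NT E)
    (hX : Dang E s u X) (hY : Dang E s u Y) (hsu : s(s, u) ∈ E)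
    (mX : ∀ W, Dang E s u W → X ⊆ W → W = X) {x y : V} (hx : x ∈ X) (hxY : x ∉ Y)
    (hy : y ∈ Y) (hyX : y ∉ X) :
    (Tight E u ∧ X ∩ Y = {u}) ∨
    (P E s X + P E s Y ≤ P E s (X \ Y) + P E s (Y \ X) ∧ X \ Y = {x} ∧ Y \ X = {y}) := by
  obtain ⟨a1, a2, a3⟩ := hX
  obtain ⟨b1, b2, b3⟩ := hY
  rcases Rs_skew (rhs_comm E s) X Y with h | h
  · left
    have hn : ¬ Dang E s u (X ∪ Y) := by
      intro hd
      have := mX _ hd subset_union_left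
      apply hyX
      rw [← this]; simp [hy]
    have hn' : P E s (X ∪ Y) + 2 ≤ d E (X ∪ Y) := by
      by_contra hc
      exact hn ⟨by simp [a1, b1], by simp [a2], by omega⟩
    have h2 := d_submod E X Y
    have h3 := P_le_Rh E s (X ∩ Y)
    have h4 : d E (X ∩ Y) ≤ Rh E (X ∩ Y) := by unfold P at *; omega
    rcases nt.single (x := u) (y := s) (by simp [a2, b2]) (by simp [a1]) h4 with h5 | h5
    · exact ⟨h5.2, h5.1⟩
    · exfalso
      have : x ∈ (X ∩ Y)ᶜ := by simp [hxY]
      rw [h5.1] at this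
      simp at this
      subst this
      exact a1 hx
  · right
    have h2 : d E (X \ Y) + d E (Y \ X) + 2 ≤ d E X + d E Y := by
      apply d_le2_strict hsu
      · intro e he
        induction e using Sym2.ind with | _ a b =>
          simp only [ind_mk, mem_sdiff]; grind
      · simp only [ind_mk, mem_sdiff]; grind
    have h3 := P_le_Rh E s (X \ Y)
    have h4 := P_le_Rh E s (Y \ X)
    have h5 := Rh_le E (X \ Y)
    have h6 := Rh_le E (Y \ X)
    have hus : u ≠ s := by rintro rfl; exact a1 a2
    refine ⟨h, ?_, ?_⟩
    · rcases nt.single (x := x) (y := s) (X := X \ Y) (by simp [*]) (by simp [a1]) (by unfold P at *; omega) with h7 | h7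
      · exact h7.1
      · exfalso
        have : u ∈ (X \ Y)ᶜ := by simp [b2]
        rw [h7.1] at this
        simp at this
        exact hus this
    · rcases nt.single (x := y) (y := s) (X := Y \ X) (by simp [*]) (by simp [b1]) (by unfold P at *; omega) with h7 | h7
      · exact h7.1
      · exfalso
        have : u ∈ (Y \ X)ᶜ := by simp [a2]
        rw [h7.1] at this
        simp at this
        exact hus this

theorem P_mono_u {E : Multiset (Sym2 V)} {s u : V} {X X0 : Finset V} {x : V} {m : ℕ}
    (H1 : ∀ a b, a ≠ b → min (min (Rh E {a}) (Rh E {b})) m ≤ lam E a b)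
    (hum : Rh E {u} < m) (hux : Rh E {u} ≤ Rh E {x}) (hx : x ∈ X0) (hxs : x ≠ s) 
    (h0 : X0 ⊆ X) (h1 : X ⊆ insert u X0) : P E s X ≤ P E s X0 := by
  rcases Nat.eq_zero_or_pos (P E s X) with h | h
  · omega
  · obtain ⟨a, ha, b, hb, has, hbs, e⟩ := exists_P_pos h
    rw [e]
    have hb0 : b ∉ X0 := fun h => hb (h0 h)
    by_cases ha0 : a ∈ X0
    · exact rh_le_P ha0 hb0 has hbs
    · have hau : a = u := by
        have := h1 ha
        simp [ha0] at this; exact this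
      subst hau
      refine le_trans ?_ (rh_le_P hx hb0 hxs hbs)
      have hab : a ≠ b := by rintro rfl; exact hb ha
      have hxb : x ≠ b := by rintro rfl; exact hb0 hx
      have g1 : rh E a b ≤ Rh E {a} := le_Rs (by simp) (by simpa using hab.symm)
      have g2 : rh E a b ≤ Rh E {b} := by rw [rh_comm]; exact le_Rs (by simp) (by simpa using hab)
      have g3 := H1 x b hxb
      unfold rh at *
      omega

theorem dang_triple {E : Multiset (Sym2 V)} {s u y0 : V} {X Y Z : Finset V} {m : ℕ} (nt : NT E)
    (H1 : ∀ a b, a ≠ b → min (min (Rh E {a}) (Rh E {b})) m ≤ lam E a b)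
    (Hu : Tight E u → Rh E {u} < m ∧ ∀ v, v ≠ s → s(s, v) ∈ E → Rh E {u} ≤ Rh E {v})
    (hk2 : 2 ≤ d E {s}) (hy0 : y0 ≠ s) (hr : d E {s} ≤ rh E s y0)
    (hX : Dang E s u X) (hY : Dang E s u Y) (hZ : Dang E s u Z) (hsu : s(s, u) ∈ E)
    (mX : ∀ W, Dang E s u W → X ⊆ W → W = X) (mY : ∀ W, Dang E s u W → Y ⊆ W → W = Y)
    {x y z : V} (hx : x ∈ X) (hxY : x ∉ Y) (hxZ : x ∉ Z) (hsx : s(s, x) ∈ E)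
    (hy : y ∈ Y) (hyX : y ∉ X) (hyZ : y ∉ Z) (hsy : s(s, y) ∈ E)
    (hz : z ∈ Z) (hzX : z ∉ X) (hzY : z ∉ Y) (hsz : s(s, z) ∈ E) : False := by
  have pXY := dang_pair nt hX hY hsu mX hx hxY hy hyX
  have pXZ := dang_pair nt hX hZ hsu mX hx hxZ hz hzX
  have pYZ := dang_pair nt hY hZ hsu mY hy hyZ hz hzY
  obtain ⟨a1, a2, a3⟩ := hX
  obtain ⟨b1, b2, b3⟩ := hY
  obtain ⟨c1, c2, c3⟩ := hZ
  have hxs : x ≠ s := by rintro rfl; exact a1 hx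
  have hys : y ≠ s := by rintro rfl; exact b1 hy
  have hzs : z ≠ s := by rintro rfl; exact c1 hz
  have hX0 : x ∈ X \ (Y ∪ Z) := by simp [*]
  have hY0 : y ∈ Y \ (X ∪ Z) := by simp [*]
  have hZ0 : z ∈ Z \ (X ∪ Y) := by simp [*]
  have mxX : Tight E u → X ⊆ insert u (X \ (Y ∪ Z)) → P E s X ≤ P E s (X \ (Y ∪ Z)) := fun ht h =>
    P_mono_u H1 (Hu ht).1 ((Hu ht).2 x hxs hsx) hX0 hxs sdiff_subset h
  have mxY : Tight E u → Y ⊆ insert u (Y \ (X ∪ Z)) → P E s Y ≤ P E s (Y \ (X ∪ Z)) := fun ht h =>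
    P_mono_u H1 (Hu ht).1 ((Hu ht).2 y hys hsy) hY0 hys sdiff_subset h
  have mxZ : Tight E u → Z ⊆ insert u (Z \ (X ∪ Y)) → P E s Z ≤ P E s (Z \ (X ∪ Y)) := fun ht h =>
    P_mono_u H1 (Hu ht).1 ((Hu ht).2 z hzs hsz) hZ0 hzs sdiff_subset h
  have key : P E s X + P E s Y + P E s Z ≤ 
      P E s (X \ (Y ∪ Z)) + P E s (Y \ (X ∪ Z)) + P E s (Z \ (X ∪ Y)) := by
    have eX1 : X \ Y = {x} → X \ (Y ∪ Z) = X \ Y := by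
      intro h; rw [h]; ext w
      have := congrArg (w ∈ ·) h
      simp only [mem_sdiff, mem_union, mem_singleton] at *
      grind
    have eX2 : X \ Z = {x} → X \ (Y ∪ Z) = X \ Z := by
      intro h; rw [h]; ext w
      have := congrArg (w ∈ ·) h
      simp only [mem_sdiff, mem_union, mem_singleton] at *
      grind
    have eY1 : Y \ X = {y} → Y \ (X ∪ Z) = Y \ X := by
      intro h; rw [h]; ext w
      have := congrArg (w ∈ ·) h
      simp only [mem_sdiff, mem_union, mem_singleton] at *
      grind
    have eY2 : Y \ Z = {y} → Y \ (X ∪ Z) = Y \ Z := by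
      intro h; rw [h]; ext w
      have := congrArg (w ∈ ·) h
      simp only [mem_sdiff, mem_union, mem_singleton] at *
      grind
    have eZ1 : Z \ X = {z} → Z \ (X ∪ Y) = Z \ X := by
      intro h; rw [h]; ext w
      have := congrArg (w ∈ ·) h
      simp only [mem_sdiff, mem_union, mem_singleton] at *
      grind
    have eZ2 : Z \ Y = {z} → Z \ (X ∪ Y) = Z \ Y := by
      intro h; rw [h]; ext w
      have := congrArg (w ∈ ·) h
      simp only [mem_sdiff, mem_union, mem_singleton] at *
      grind
    have sX : X ∩ Y ⊆ {u} → X ∩ Z ⊆ {u} → X ⊆ insert u (X \ (Y ∪ Z)) := by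
      intro h1 h2 w hw
      have := @h1 w
      have := @h2 w
      simp only [mem_inter, mem_singleton, mem_insert, mem_sdiff, mem_union] at *
      grind
    have sY : X ∩ Y ⊆ {u} → Y ∩ Z ⊆ {u} → Y ⊆ insert u (Y \ (X ∪ Z)) := by
      intro h1 h2 w hw
      have := @h1 w
      have := @h2 w
      simp only [mem_inter, mem_singleton, mem_insert, mem_sdiff, mem_union] at *
      grind
    have sZ : X ∩ Z ⊆ {u} → Y ∩ Z ⊆ {u} → Z ⊆ insert u (Z \ (X ∪ Y)) := by
      intro h1 h2 w hw
      have := @h1 w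
      have := @h2 w
      simp only [mem_inter, mem_singleton, mem_insert, mem_sdiff, mem_union] at *
      grind
    rcases pXY with ⟨t, p⟩ | ⟨p, p1, p2⟩ <;> rcases pXZ with ⟨t', q⟩ | ⟨q, q1, q2⟩ <;>
      rcases pYZ with ⟨t'', r⟩ | ⟨r, r1, r2⟩
    · have := mxX t (sX p.subset q.subset)
      have := mxY t (sY p.subset r.subset)
      have := mxZ t (sZ q.subset r.subset)
      omega
    · have := mxX t (sX p.subset q.subset)
      rw [← eY2 r1, ← eZ2 r2] at r
      omega
    · have := mxY t (sY p.subset r.subset)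
      rw [← eX2 q1, ← eZ1 q2] at q
      omega
    · have hYZ : Y ∩ Z ⊆ {u} := by
        intro w hw
        have h1 := congrArg (w ∈ ·) q2
        have h2 := congrArg (w ∈ ·) p
        simp only [mem_inter, mem_singleton, mem_sdiff] at *
        grind
      have := mxY t (sY p.subset hYZ)
      rw [← eX2 q1, ← eZ1 q2] at q
      omega
    · have := mxZ t' (sZ q.subset r.subset)
      rw [← eX1 p1, ← eY1 p2] at p
      omega
    · have hXY : X ∩ Y ⊆ {u} := by
        intro w hw
        have h1 := congrArg (w ∈ ·) r1
        have h2 := congrArg (w ∈ ·) q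
        simp only [mem_inter, mem_singleton, mem_sdiff] at *
        grind
      have := mxX t' (sX hXY q.subset)
      rw [← eY2 r1, ← eZ2 r2] at r
      omega
    · have hXZ : X ∩ Z ⊆ {u} := by
        intro w hw
        have h1 := congrArg (w ∈ ·) p1
        have h2 := congrArg (w ∈ ·) r
        simp only [mem_inter, mem_singleton, mem_sdiff] at *
        grind
      have := mxZ t'' (sZ hXZ r.subset)
      rw [← eX1 p1, ← eY1 p2] at p
      omega
    · rw [← eX1 p1, ← eY1 p2] at p
      rw [← eX2 q1, ← eZ1 q2] at q
      rw [← eY2 r1, ← eZ2 r2] at r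
      omega
  have trip : d E (X ∩ Y ∩ Z) + d E (X \ (Y ∪ Z)) + d E (Y \ (X ∪ Z)) + d E (Z \ (X ∪ Y)) + 2 ≤
      d E X + d E Y + d E Z := by
    have gen : ∀ F : Multiset (Sym2 V), d F (X ∩ Y ∩ Z) + d F (X \ (Y ∪ Z)) + d F (Y \ (X ∪ Z)) + d F (Z \ (X ∪ Y)) ≤
        d F X + d F Y + d F Z := by
      intro F
      induction F using Multiset.induction with
      | empty => simp [d_zero]
      | cons e F ih =>
        simp only [d_cons]
        have : ind (X ∩ Y ∩ Z) e + ind (X \ (Y ∪ Z)) e + ind (Y \ (X ∪ Z)) e + ind (Z \ (X ∪ Y)) e ≤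
            ind X e + ind Y e + ind Z e := by
          clear * -
          induction e using Sym2.ind with | _ a b =>
          simp only [ind_mk, mem_sdiff, mem_union, mem_inter]
          by_cases a ∈ X <;> by_cases a ∈ Y <;> by_cases a ∈ Z <;>
          by_cases b ∈ X <;> by_cases b ∈ Y <;> by_cases b ∈ Z <;> simp [*]
        omega
    obtain ⟨F, rfl⟩ := Multiset.exists_cons_of_mem hsu
    have := gen F
    simp only [d_cons]
    have : ind (X ∩ Y ∩ Z) s(s,u) + ind (X \ (Y ∪ Z)) s(s,u) + ind (Y \ (X ∪ Z)) s(s,u) + ind (Z \ (X ∪ Y)) s(s,u) + 2 ≤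
            ind X s(s,u) + ind Y s(s,u) + ind Z s(s,u) := by
      simp [ind_mk, a1, b1, c1, a2, b2, c2]
    omega
  have l1 := (P_le_Rh E s (X \ (Y ∪ Z))).trans (Rh_le _ _)
  have l2 := (P_le_Rh E s (Y \ (X ∪ Z))).trans (Rh_le _ _)
  have l3 := (P_le_Rh E s (Z \ (X ∪ Y))).trans (Rh_le _ _)
  have hI : d E (X ∩ Y ∩ Z) ≤ 1 := by omega
  by_cases hyI : y0 ∈ X ∩ Y ∩ Z
  · have := rh_le (E := E) (x := y0) (y := s) hyI (by simp [a1])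
    rw [rh_comm] at this
    omega
  · have h1 := rh_le (E := E) (x := s) (y := y0) (X := insert s (X ∩ Y ∩ Z)) (by simp) 
      (by simp only [mem_insert, not_or]; exact ⟨hy0, hyI⟩)
    have h2 : d E (insert s (X ∩ Y ∩ Z)) + d E ∅ + 2 ≤ d E (X ∩ Y ∩ Z) + d E {s} := by
      apply d_le2_strict hsu
      · intro e he
        induction e using Sym2.ind with | _ a b =>
          simp only [ind_mk, mem_insert, mem_singleton, notMem_empty]; grind
      · have hus : u ≠ s := by rintro rfl; exact a1 a2
        simp [ind_mk, a1, a2, b2, c2, hus]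
    omega

theorem split_exists {E : Multiset (Sym2 V)} {s u y0 : V} {m : ℕ} (nt : NT E)
    (H1 : ∀ a b, a ≠ b → min (min (Rh E {a}) (Rh E {b})) m ≤ lam E a b)
    (Hu : Tight E u → Rh E {u} < m ∧ ∀ v, v ≠ s → s(s, v) ∈ E → Rh E {u} ≤ Rh E {v})
    (hk2 : 2 ≤ d E {s}) (hke : d E {s} % 2 = 0) (hy0 : y0 ≠ s) (hr : d E {s} ≤ rh E s y0)
    (hus : u ≠ s) (hsu : s(s, u) ∈ E) :
    ∃ v E0, v ≠ s ∧ E = s(s, u) ::ₘ s(s, v) ::ₘ E0 ∧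
      ∀ x y, x ≠ s → y ≠ s → x ≠ y → rh E x y ≤ rh (s(u, v) ::ₘ E0) x y := by
  by_contra hcon
  push Not at hcon
  have hd : ∀ v E0, v ≠ s → E = s(s, u) ::ₘ s(s, v) ::ₘ E0 → ∃ X, Dang E s u X ∧ v ∈ X := by
    intro v E0 hv hE
    obtain ⟨x, y, hx, hy, hxy, hlt⟩ := hcon v E0 hv hE
    obtain ⟨X, hxX, hyX, hX⟩ : ∃ X : Finset V, x ∈ X ∧ y ∉ X ∧ d (s(u, v) ::ₘ E0) X = lam (s(u, v) ::ₘ E0) x y :=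
      lam_att _ hxy
    have main : ∀ (x y : V) (X : Finset V), x ≠ s → y ≠ s → x ∈ X → y ∉ X → s ∉ X → 
        d (s(u, v) ::ₘ E0) X < rh E x y → ∃ X, Dang E s u X ∧ v ∈ X := by
      intro x y X hxs hys hx hy hsX hlt
      have h1 := rh_le (E := E) hx hy
      have h2 : d E X = ind X s(s, u) + (ind X s(s, v) + d E0 X) := by
        rw [hE]; simp only [d_cons]
      rw [d_cons] at hlt
      have h3 := ind_split X s u v
      have h4 := ind_le_one X s(s, u)
      have h5 := ind_le_one X s(s, v)
      have h6 : ind X s(s, u) = 1 ∧ ind X s(s, v) = 1 ∧ ind X s(u, v) = 0 := by omega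
      have h7 := rh_le_P (E := E) hx hy hxs hys
      refine ⟨X, ⟨hsX, ?_, by omega⟩, ?_⟩
      · have := h6.1; simp only [ind_mk] at this; grind
      · have := h6.2.1; simp only [ind_mk] at this; grind
    have hlt' : d (s(u, v) ::ₘ E0) X < rh E x y := by unfold rh at *; omega
    by_cases hsX : s ∈ X
    · refine main y x Xᶜ hy hx (by simpa using hyX) (by simpa using hxX) (by simpa using hsX) ?_
      rw [d_compl, rh_comm]; exact hlt'
    · exact main x y X hx hy hxX hyX hsX hlt'
  obtain ⟨E1, hE1⟩ := Multiset.exists_cons_of_mem hsu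
  have hcov : ∀ v, v ≠ s → s(s, v) ∈ E → ∃ X, Dang E s u X ∧ v ∈ X := by
    intro v hv hsv
    by_cases hvu : v = u
    · subst hvu
      have h1 : 0 < d E1 {s} := by
        rw [hE1, d_cons] at hk2
        have := ind_le_one {s} s(s, v)
        omega
      obtain ⟨e, he, h2⟩ := exists_of_d_pos h1
      obtain ⟨w, hw, rfl⟩ := ind_single_exists h2
      obtain ⟨E0, hE0⟩ := Multiset.exists_cons_of_mem he
      obtain ⟨X, hX, _⟩ := hd w E0 hw (by rw [hE1, hE0])
      exact ⟨X, hX, hX.2.1⟩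
    · have : s(s, v) ∈ E1 := by
        rw [hE1, Multiset.mem_cons] at hsv
        rcases hsv with h | h
        · rw [Sym2.eq_iff] at h; grind
        · exact h
      obtain ⟨E0, hE0⟩ := Multiset.exists_cons_of_mem this
      exact hd v E0 hv (by rw [hE1, hE0])
  classical
  -- the maximal dangerous sets
  let MD : Finset (Finset V) := univ.filter (fun X => Dang E s u X ∧ ∀ W, Dang E s u W → X ⊆ W → W = X)
  have hMD : ∀ X, Dang E s u X → ∃ Y ∈ MD, X ⊆ Y := by
    intro X hX
    obtain ⟨Y, hXY, hY⟩ := Finset.exists_le_maximal (univ.filter (fun X => Dang E s u X)) (a := X) (by simpa using hX)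
    refine ⟨Y, ?_, hXY⟩
    have h1 := hY.1
    simp only [mem_filter, mem_univ, true_and, MD] at h1 ⊢
    exact ⟨h1, fun W hW hYW => subset_antisymm (hY.2 (by simpa using hW) hYW) hYW⟩
  let cov : Finset (Finset V) → Prop := fun 𝓕 => ∀ v, v ≠ s → s(s, v) ∈ E → ∃ X ∈ 𝓕, v ∈ X
  have hex : (MD.powerset.filter cov).Nonempty := by
    refine ⟨MD, ?_⟩
    simp only [mem_filter, mem_powerset, subset_refl, true_and]
    intro v hv hsv
    obtain ⟨X, hX, hvX⟩ := hcov v hv hsv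
    obtain ⟨Y, hY, hXY⟩ := hMD X hX
    exact ⟨Y, hY, hXY hvX⟩
  obtain ⟨𝓕, h𝓕, hmin⟩ := Finset.exists_min_image _ Finset.card hex
  simp only [mem_filter, mem_powerset] at h𝓕
  obtain ⟨hsub, hcv⟩ := h𝓕
  have hmem : ∀ X ∈ 𝓕, Dang E s u X ∧ ∀ W, Dang E s u W → X ⊆ W → W = X := by
    intro X hX; have := hsub hX; simpa [MD] using this
  have hpriv : ∀ X ∈ 𝓕, ∃ x, x ∈ X ∧ s(s, x) ∈ E ∧ ∀ Y ∈ 𝓕, Y ≠ X → x ∉ Y := by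
    intro X hX
    have : ¬ cov (𝓕.erase X) := by
      intro hc
      have := hmin (𝓕.erase X) (by
        simp only [mem_filter, mem_powerset]
        exact ⟨(erase_subset _ _).trans hsub, hc⟩)
      have := card_erase_lt_of_mem hX
      omega
    simp only [cov] at this
    push Not at this
    obtain ⟨v, hv, hsv, hno⟩ := this
    obtain ⟨Y, hY, hvY⟩ := hcv v hv hsv
    have : Y = X := by
      by_contra hne
      exact hno Y (mem_erase.2 ⟨hne, hY⟩) hvY
    subst this
    exact ⟨v, hvY, hsv, fun W hW hne => hno W (mem_erase.2 ⟨hne, hW⟩)⟩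
  by_cases hcard : 2 < 𝓕.card
  · obtain ⟨X, hX, Y, hY, Z, hZ, hXY, hXZ, hYZ⟩ := two_lt_card.1 hcard
    obtain ⟨x, hx, hsx, hx'⟩ := hpriv X hX
    obtain ⟨y, hy, hsy, hy'⟩ := hpriv Y hY
    obtain ⟨z, hz, hsz, hz'⟩ := hpriv Z hZ
    exact dang_triple nt H1 Hu hk2 hy0 hr (hmem X hX).1 (hmem Y hY).1 (hmem Z hZ).1 hsu
      (hmem X hX).2 (hmem Y hY).2 hx (hx' Y hY hXY.symm) (hx' Z hZ hXZ.symm) hsx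
      hy (hy' X hX hXY) (hy' Z hZ hYZ.symm) hsy hz (hz' X hX hXZ) (hz' Y hY hYZ) hsz
  · obtain ⟨X, hX, hXu⟩ := hcv u hus hsu
    have h1 : (𝓕.erase X).card ≤ 1 := by rw [card_erase_of_mem hX]; omega
    obtain ⟨Y, hY, hXY⟩ : ∃ Y ∈ 𝓕, ∀ W ∈ 𝓕, W = X ∨ W = Y := by
      rcases (𝓕.erase X).eq_empty_or_nonempty with h0 | ⟨Y, hY⟩
      · refine ⟨X, hX, fun W hW => ?_⟩
        by_contra hc
        have : W ∈ 𝓕.erase X := mem_erase.2 ⟨by tauto, hW⟩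
        rw [h0] at this; simp at this
      · refine ⟨Y, (mem_erase.1 hY).2, fun W hW => ?_⟩
        by_contra hc
        have : W ∈ 𝓕.erase X := mem_erase.2 ⟨by tauto, hW⟩
        have := card_le_one.1 h1 W this Y hY
        tauto
    refine dang_two (hmem X hX).1 (hmem Y hY).1 hke hsu (fun v hv hsv => ?_)
    obtain ⟨W, hW, hvW⟩ := hcv v hv hsv
    rcases hXY W hW with rfl | rfl
    · left; exact hvW
    · right; exact hvW

end split
end NW

namespace NW
open Finset

section main
variable {V : Type u} [DecidableEq V] [Fintype V]

theorem rh_le_left (E : Multiset (Sym2 V)) {a b : V} (h : a ≠ b) : rh E a b ≤ Rh E {a} :=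
  le_Rs (by simp) (by simpa using h.symm)

theorem rh_le_right (E : Multiset (Sym2 V)) {a b : V} (h : a ≠ b) : rh E a b ≤ Rh E {b} := by
  rw [rh_comm]; exact rh_le_left E h.symm

theorem gap_odd {E : Multiset (Sym2 V)} (nt : NT E) {a b : V} (h : a ≠ b)
    (h1 : lam E a b < Rh E {a}) (h2 : lam E a b < Rh E {b}) : lam E a b % 2 = 1 := by
  by_contra hc
  obtain ⟨X, hx, hy, e⟩ := lam_att E h
  have h3 : rh E a b ≤ Rh E X := le_Rs hx hy
  have h4 : d E X ≤ Rh E X := by unfold rh at h3; omega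
  rcases nt.single hx hy h4 with ⟨h5, _⟩ | ⟨h5, _⟩
  · have := Rh_le E {a}
    rw [← h5] at this h1; omega
  · have := Rh_le E {b}
    rw [← h5, d_compl] at this
    rw [← h5] at h2; omega

theorem exists_m {E : Multiset (Sym2 V)} (nt : NT E) :
    ∃ m, (∀ a b, a ≠ b → min (min (Rh E {a}) (Rh E {b})) m ≤ lam E a b) ∧
      ((∃ a b, a ≠ b ∧ lam E a b = m ∧ m < Rh E {a} ∧ m < Rh E {b} ∧ m % 2 = 1) ∨
        ∀ v, Rh E {v} < m) := by
  classical
  let p : ℕ → Prop := fun n => ∃ a b, a ≠ b ∧ lam E a b = n ∧ n < Rh E {a} ∧ n < Rh E {b}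
  by_cases h : ∃ n, p n
  · refine ⟨Nat.find h, ?_, Or.inl ?_⟩
    · intro a b hab
      by_contra hc
      have h2 : p (lam E a b) := ⟨a, b, hab, rfl, by omega, by omega⟩
      have := Nat.find_min' h h2
      omega
    · obtain ⟨a, b, hab, h1, h2, h3⟩ := Nat.find_spec h
      refine ⟨a, b, hab, h1, h2, h3, ?_⟩
      rw [← h1] at h2 h3 ⊢
      exact gap_odd nt hab h2 h3
  · refine ⟨univ.sup (fun v => Rh E {v}) + 1, ?_, Or.inr ?_⟩
    · intro a b hab
      by_contra hc
      exact h ⟨lam E a b, a, b, hab, rfl, by omega, by omega⟩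
    · intro v
      have := Finset.le_sup (f := fun v => Rh E {v}) (mem_univ v)
      omega

theorem step3A (E : Multiset (Sym2 V)) (ih : IH V E.card) (nt : NT E)
    (ET : ∀ e ∈ E, ∃ v, Tight E v ∧ ind {v} e = 1) {m : ℕ}
    (H1 : ∀ a b, a ≠ b → min (min (Rh E {a}) (Rh E {b})) m ≤ lam E a b)
    {a0 b0 : V} (he0 : s(a0, b0) ∈ E) (ha0 : Rh E {a0} < m) (hb0 : Rh E {b0} < m) :
    ∃ M, Feas E M := by
  classical
  let C : Finset V := univ.filter (fun s => Tight E s ∧ Rh E {s} < m ∧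
    ∃ t, t ≠ s ∧ s(s, t) ∈ E ∧ Rh E {t} < m)
  have hCe : ∀ a b, s(a, b) ∈ E → Rh E {a} < m → Rh E {b} < m → a ∈ C ∨ b ∈ C := by
    intro a b hab ha hb
    obtain ⟨v, hv, h1⟩ := ET _ hab
    simp only [C, mem_filter, mem_univ, true_and]
    simp only [ind_mk, mem_singleton] at h1
    by_cases hav : a = v
    · subst hav
      left
      exact ⟨hv, ha, b, by grind, hab, hb⟩
    · by_cases hbv : b = v
      · subst hbv
        right
        exact ⟨hv, hb, a, hav, by rw [Sym2.eq_swap]; exact hab, ha⟩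
      · grind
  have hne : C.Nonempty := by
    rcases hCe a0 b0 he0 ha0 hb0 with h | h
    · exact ⟨_, h⟩
    · exact ⟨_, h⟩
  obtain ⟨s, hs, hsmin⟩ := Finset.exists_min_image C (fun s => d E {s}) hne
  have hs' := hs
  simp only [C, mem_filter, mem_univ, true_and] at hs'
  obtain ⟨hst, hsm, t, hts, het, htm⟩ := hs'
  have hst' : d E {s} = Rh E {s} := hst
  have hke := Rh_even E {s}
  rw [← hst'] at hke
  have hpos : 1 ≤ d E {s} := by
    have := d_pos_of_mem het {s}
    have h2 : ind {s} s(s, t) = 1 := by simp [ind_mk, hts]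
    omega
  have hk2 : 2 ≤ d E {s} := by omega
  obtain ⟨y0, hy0, hr⟩ : ∃ y0, y0 ≠ s ∧ Rh E {s} = rh E s y0 := by
    obtain ⟨x, hx, y, hy, e⟩ := exists_Rs_pos (rh E) (X := {s}) (by unfold Rh at hst'; omega)
    simp at hx hy
    subst hx
    exact ⟨y, hy, e⟩
  -- choice of u
  obtain ⟨u, hus, hsu, Hu⟩ : ∃ u, u ≠ s ∧ s(s, u) ∈ E ∧ (Tight E u → Rh E {u} < m ∧
      ∀ v, v ≠ s → s(s, v) ∈ E → Rh E {u} ≤ Rh E {v}) := by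
    by_cases h : ∃ u, u ≠ s ∧ s(s, u) ∈ E ∧ ¬ Tight E u
    · obtain ⟨u, h1, h2, h3⟩ := h
      exact ⟨u, h1, h2, fun h => absurd h h3⟩
    · obtain ⟨u, hu, humin⟩ := Finset.exists_min_image
        (univ.filter (fun u => u ≠ s ∧ s(s, u) ∈ E)) (fun u => Rh E {u}) ⟨t, by simp [hts, het]⟩
      simp only [mem_filter, mem_univ, true_and] at hu humin
      exact ⟨u, hu.1, hu.2, fun _ => ⟨lt_of_le_of_lt (humin t ⟨hts, het⟩) htm,
        fun v h1 h2 => humin v ⟨h1, h2⟩⟩⟩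
  obtain ⟨v, E0, hvs, hE, hsp⟩ := split_exists nt H1 Hu hk2 hke hy0 (by omega) hus hsu
  obtain ⟨M0, hM0⟩ := ih V (s(u, v) ::ₘ E0) (by rw [hE]; simp)
  obtain ⟨M, ⟨hM1, hM2⟩, hM3⟩ := hM0.norm
  have hdX : ∀ X, d (s(u, v) ::ₘ E0) X ≤ d E X := by
    intro X
    rw [hE]; simp only [d_cons]
    have := ind_split X s u v
    omega
  have hpar : ∀ w, d M {w} % 2 = d E {w} % 2 := by
    intro w
    rw [hM1, hE]; simp only [d_cons]
    have := ind_split {w} s u v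
    omega
  have hMs : d M {s} = 0 := by
    have := hpar s
    have := hM3 s
    omega
  have mainS : ∀ X : Finset V, s ∈ X → ∀ y ∉ X, d M X + rh E s y ≤ d E X := by
    intro X hsX y hy
    have hsy : s ≠ y := by rintro rfl; exact hy hsX
    have q1 := rh_le_left E hsy
    have q2 := rh_le_right E hsy
    by_cases hz : ∃ z ∈ X, z ≠ s ∧ rh E s y ≤ Rh E {z}
    · obtain ⟨z, hzX, hzs, hzq⟩ := hz
      have hzy : z ≠ y := by rintro rfl; exact hy hzX
      have h1 := H1 z y hzy
      have h2 := hsp z y hzs hsy.symm hzy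
      have h3 : rh (s(u, v) ::ₘ E0) z y ≤ Rh (s(u, v) ::ₘ E0) X := le_Rs hzX hy
      have h4 := hM2 X
      have h5 := hdX X
      have h6 : rh E s y ≤ rh E z y := by unfold rh at *; omega
      omega
    · push Not at hz
      have hlow : ∀ z ∈ X, z ≠ s → Rh E {z} < d E {s} := by
        intro z h1 h2
        have := hz z h1 h2
        omega
      have hind : ∀ a b, s(a, b) ∈ E → a ∈ X → b ∈ X → a = s ∨ b = s := by
        intro a b hab ha hb
        by_contra hc
        push Not at hc
        have l1 := hlow a ha hc.1
        have l2 := hlow b hb hc.2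
        rcases hCe a b hab (by omega) (by omega) with h | h
        · have h1 := hsmin a h
          have h2 : d E {a} = Rh E {a} := (mem_filter.1 h).2.1
          omega
        · have h1 := hsmin b h
          have h2 : d E {b} = Rh E {b} := (mem_filter.1 h).2.1
          omega
      have claim : ∀ S : Finset V, S ⊆ X.erase s →
          d E {s} + ∑ z ∈ S, d E {z} % 2 ≤ d E (insert s S) := by
        intro S
        induction S using Finset.induction with
        | empty => intro _; simp
        | insert z S hzS ihS =>
          intro hsub
          have h1 := ihS (fun w hw => hsub (by simp [hw]))
          rw [sum_insert hzS]
          have hzX := hsub (mem_insert_self z S)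
          rw [mem_erase] at hzX
          have hSX : ∀ w ∈ S, w ∈ X ∧ w ≠ s := by
            intro w hw
            have := hsub (mem_insert_of_mem hw)
            rw [mem_erase] at this
            exact ⟨this.2, this.1⟩
          have h2 : d E {s, z} + d E (insert s S) ≤ d E (insert s (insert z S)) + d E {s} := by
            apply d_le2
            intro e he
            induction e using Sym2.ind with | _ a b =>
              have := hind a b he
              have := hSX a
              have := hSX b
              simp only [ind_mk, mem_insert, mem_singleton]
              grind
          have hy0z : y0 ≠ z := by
            rintro rfl
            have := hlow y0 hzX.2 hzX.1
            have := rh_le_right E hy0.symm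
            omega
          have h3 := rh_le (E := E) (x := s) (y := y0) (X := {s, z}) (by simp) (by simp [hy0, hy0z])
          have h4 := d_parity_insert E {z} s (by simpa using hzX.1.symm)
          have h5 : d E (insert s {z}) = d E {s, z} := rfl
          omega
      have h1 := claim (X.erase s) subset_rfl
      rw [insert_erase hsX] at h1
      have h2 := d_le_sum M X
      rw [← add_sum_erase X _ hsX, hMs] at h2
      have h3 : ∑ z ∈ X.erase s, d M {z} ≤ ∑ z ∈ X.erase s, d E {z} % 2 := by
        apply sum_le_sum
        intro z _
        have := hpar z
        have := hM3 z
        omega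
      omega
  refine ⟨M, hpar, fun X => ?_⟩
  rcases Nat.eq_zero_or_pos (Rh E X) with h0 | h0
  · have := hM2 X
    have := hdX X
    omega
  · obtain ⟨x, hx, y, hy, e⟩ := exists_Rs_pos (rh E) h0
    have e' : Rh E X = rh E x y := e
    by_cases hxs : x = s
    · subst hxs
      rw [e']; exact mainS X hx y hy
    by_cases hys : y = s
    · subst hys
      have := mainS Xᶜ (by simpa using hy) x (by simpa using hx)
      rw [d_compl, d_compl, rh_comm] at this
      rw [e']; exact this
    have hxy : x ≠ y := by rintro rfl; exact hy hx
    have h1 := hsp x y hxs hys hxy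
    have h3 : rh (s(u, v) ::ₘ E0) x y ≤ Rh (s(u, v) ::ₘ E0) X := le_Rs hx hy
    have h4 := hM2 X
    have h5 := hdX X
    omega

/-- data of an odd gap cut -/
def Gap (E M : Multiset (Sym2 V)) (m : ℕ) (Z : Finset V) : Prop :=
  d E Z = m ∧ (∃ a ∈ Z, m ≤ Rh E {a}) ∧ (∃ b, b ∉ Z ∧ m ≤ Rh E {b}) ∧
  ∀ X : Finset V, (X ⊆ Z ∨ X ⊆ Zᶜ ∨ Z ⊆ X ∨ Zᶜ ⊆ X) → d M X + Rh E X ≤ d E X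

theorem Gap.compl {E M : Multiset (Sym2 V)} {m : ℕ} {Z : Finset V} (h : Gap E M m Z) :
    Gap E M m Zᶜ := by
  obtain ⟨h1, ⟨a, ha⟩, ⟨b, hb⟩, h4⟩ := h
  refine ⟨by rw [d_compl]; exact h1, ⟨b, by simpa using hb⟩, ⟨a, by simpa using ha⟩, ?_⟩
  intro X hX
  apply h4
  rw [compl_compl] at hX
  tauto

theorem quad {E M : Multiset (Sym2 V)} {m : ℕ} {Z : Finset V}
    (H1 : ∀ a b, a ≠ b → min (min (Rh E {a}) (Rh E {b})) m ≤ lam E a b)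
    (hlow : ∀ a b, s(a, b) ∈ E → Rh E {a} < m → Rh E {b} < m → False) (hm : m % 2 = 1)
    (hpar : ∀ v, d M {v} % 2 = d E {v} % 2) (hM1 : ∀ v, d M {v} ≤ 1)
    (hG : Gap E M m Z) (Y : Finset V) (hF : ∀ f ∈ Z, f ∉ Y → Rh E {f} < m) :
    d M Y + Rh E Y ≤ d E Y := by
  obtain ⟨hdZ, ⟨a, haZ, ham⟩, ⟨b, hbZ, hbm⟩, hfe⟩ := hG
  have claim : ∀ S : Finset V, S ⊆ Z \ Y → d M Y + d E (Y ∪ S) ≤ d M (Y ∪ S) + d E Y := by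
    intro S
    induction S using Finset.induction with
    | empty => intro _; simp
    | insert f S hfS ihS =>
      intro hsub
      have h1 := ihS (fun w hw => hsub (by simp [hw]))
      have hf := hsub (mem_insert_self f S)
      rw [mem_sdiff] at hf
      have hfl := hF f hf.1 hf.2
      have hfY : f ∉ Y ∪ S := by simp [hf.2, hfS]
      rw [union_insert]
      have haf : a ≠ f := by rintro rfl; omega
      have hab : a ≠ b := by rintro rfl; exact hbZ haZ
      have h2 := lam_le (E := E) (x := a) (y := b) (X := Z.erase f) (by simp [haf, haZ]) (by simp [hbZ])
      have h3 := H1 a b hab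
      have h4 : d E (insert f (Y ∪ S)) + d E (Z.erase f) ≤ d E (Y ∪ S) + d E Z := by
        apply d_le2
        intro e he
        induction e using Sym2.ind with | _ p q =>
          have c1 : p = f → q ∈ Z → q ∈ Y := by
            rintro rfl hq
            by_contra hc
            exact hlow p q he hfl (hF q hq hc)
          have c2 : q = f → p ∈ Z → p ∈ Y := by
            rintro rfl hq
            by_contra hc
            exact hlow p q he (hF p hq hc) hfl
          simp only [mem_union] at hfY
          simp only [ind_mk, mem_insert, mem_union, mem_erase]
          grind
      have h5 := d_parity_insert E (Y ∪ S) f hfY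
      have h6 : d M (Y ∪ S) + d M ∅ ≤ d M (insert f (Y ∪ S)) + d M {f} := by
        apply d_le2
        intro e he
        induction e using Sym2.ind with | _ p q =>
          simp only [ind_mk, mem_insert, mem_singleton, notMem_empty]
          grind
      rw [d_empty] at h6
      have h7 := hpar f
      have h8 := hM1 f
      omega
  have c := claim (Z \ Y) subset_rfl
  rw [union_sdiff_self_eq_union] at c
  have fU := hfe (Y ∪ Z) (by right; right; left; exact subset_union_right)
  rcases Nat.eq_zero_or_pos (Rh E Y) with h0 | h0
  · omega
  obtain ⟨x, hx, y, hy, e⟩ := exists_Rs_pos (rh E) h0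
  have e' : Rh E Y = rh E x y := e
  have hxy : x ≠ y := by rintro rfl; exact hy hx
  by_cases hyZ : y ∈ Z
  · have hyl := hF y hyZ hy
    have hq := rh_le_right E hxy
    by_cases hb' : ∃ b', b' ∉ Y ∧ b' ∉ Z ∧ m ≤ Rh E {b'}
    · obtain ⟨b', h1, h2, h3⟩ := hb'
      have hab : a ≠ b' := by rintro rfl; exact h2 haZ
      have h4 := H1 a b' hab
      have h5 : rh E a b' ≤ Rh E (Y ∪ Z) := le_Rs (by simp [haZ]) (by simp [h1, h2])
      unfold rh at *
      omega
    · push Not at hb'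
      have hall : ∀ w ∉ Y, Rh E {w} < m := by
        intro w hw
        by_cases hwZ : w ∈ Z
        · exact hF w hwZ hw
        · exact hb' w hw hwZ
      have hsum : ∀ S : Finset V, S ⊆ Yᶜ → ∑ w ∈ S, d E {w} ≤ d E S := by
        intro S
        induction S using Finset.induction with
        | empty => intro _; simp
        | insert f S hfS ihS =>
          intro hsub
          have h1 := ihS (fun w hw => hsub (by simp [hw]))
          rw [sum_insert hfS]
          have hl : ∀ w ∈ insert f S, Rh E {w} < m := by
            intro w hw; apply hall; have := hsub hw; simpa using this
          have h2 : d E {f} + d E S ≤ d E (insert f S) + d E ∅ := by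
            apply d_le2
            intro e he
            induction e using Sym2.ind with | _ p q =>
              have c1 : p ∈ insert f S → q ∈ insert f S → False := fun h1 h2 =>
                hlow p q he (hl p h1) (hl q h2)
              simp only [ind_mk, mem_insert, mem_singleton, notMem_empty] at *
              grind
          rw [d_empty] at h2
          omega
      have hs1 := hsum Yᶜ subset_rfl
      have hs2 := d_le_sum M Yᶜ
      rw [d_compl] at hs1 hs2
      have hyc : y ∈ Yᶜ := by simpa using hy
      rw [← add_sum_erase _ _ hyc] at hs1 hs2
      have hs3 : ∑ w ∈ Yᶜ.erase y, d M {w} ≤ ∑ w ∈ Yᶜ.erase y, d E {w} := by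
        apply sum_le_sum
        intro w _
        by_cases hw : w ∈ Z
        · have := hfe {w} (by left; simpa using hw)
          omega
        · have := hfe {w} (by right; left; simpa using hw)
          omega
      have hs4 := hfe {y} (by left; simpa using hyZ)
      omega
  · have h5 : rh E x y ≤ Rh E (Y ∪ Z) := le_Rs (by simp [hx]) (by simp [hy, hyZ])
    omega

theorem step3B (E : Multiset (Sym2 V)) (ih : IH V E.card) {m : ℕ}
    (H1 : ∀ a b, a ≠ b → min (min (Rh E {a}) (Rh E {b})) m ≤ lam E a b)
    (hlow : ∀ a b, s(a, b) ∈ E → Rh E {a} < m → Rh E {b} < m → False) (hm : m % 2 = 1)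
    {a b : V} (hab : a ≠ b) (hl : lam E a b = m) (ham : m < Rh E {a}) (hbm : m < Rh E {b}) :
    ∃ M, Feas E M := by
  obtain ⟨Z, haZ, hbZ, hdZ⟩ := lam_att E hab
  rw [hl] at hdZ
  have hR1 : rh E a b ≤ Rh E Z := le_Rs haZ hbZ
  have hR2 := Rh_le E Z
  have hR3 := Rh_even E Z
  have hRZ : Rh E Z + 1 = m := by unfold rh at hR1; omega
  have hc1 : 2 ≤ Z.card := by
    by_contra hc
    have : Z = {a} := by
      apply (eq_singleton_iff_unique_mem).2 ⟨haZ, fun z hz => ?_⟩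
      by_contra hne
      exact hc (one_lt_card.2 ⟨z, hz, a, haZ, hne⟩)
    have h := Rh_le E {a}
    rw [← this] at h ham
    omega
  have hc2 : 2 ≤ (Zᶜ).card := by
    by_contra hc
    have hbZ' : b ∈ Zᶜ := by simpa using hbZ
    have : Zᶜ = {b} := by
      apply (eq_singleton_iff_unique_mem).2 ⟨hbZ', fun z hz => ?_⟩
      by_contra hne
      exact hc (one_lt_card.2 ⟨z, hz, b, hbZ', hne⟩)
    have h := Rh_le E {b}
    rw [← this, d_compl] at h
    rw [← this] at hbm
    omega
  obtain ⟨M, hpar, hM1, hfe⟩ := glue E ih Z hc1 hc2 (by omega)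
  have hfe' : ∀ X : Finset V, (X ⊆ Z ∨ X ⊆ Zᶜ ∨ Z ⊆ X ∨ Zᶜ ⊆ X) → d M X + Rh E X ≤ d E X := by
    intro X hX
    rcases hX with h | h | h | h
    · exact hfe X (Or.inl h)
    · exact hfe X (Or.inr h)
    · rw [← d_compl M, ← d_compl E, ← Rh_compl]
      exact hfe _ (Or.inr (compl_subset_compl.2 h))
    · rw [← d_compl M, ← d_compl E, ← Rh_compl]
      refine hfe _ (Or.inl ?_)
      rw [← compl_compl Z]; exact compl_subset_compl.2 h
  have hG : Gap E M m Z := ⟨hdZ, ⟨a, haZ, ham.le⟩, ⟨b, hbZ, hbm.le⟩, hfe'⟩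
  have hMZ : d M Z = 1 := by
    have h1 := hfe Z (Or.inl subset_rfl)
    have h2 := d_parity_congr hpar Z
    omega
  refine ⟨M, hpar, fun Y => ?_⟩
  have compY : d M Yᶜ + Rh E Yᶜ ≤ d E Yᶜ → d M Y + Rh E Y ≤ d E Y := by
    rw [d_compl, d_compl, Rh_compl]; exact id
  by_cases k1 : ∀ f ∈ Z, f ∉ Y → Rh E {f} < m
  · exact quad H1 hlow hm hpar hM1 hG Y k1
  by_cases k2 : ∀ f ∈ Z, f ∈ Y → Rh E {f} < m
  · exact compY (quad H1 hlow hm hpar hM1 hG Yᶜ (fun f h1 h2 => k2 f h1 (by simpa using h2)))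
  by_cases k3 : ∀ f, f ∉ Z → f ∉ Y → Rh E {f} < m
  · exact quad H1 hlow hm hpar hM1 hG.compl Y (fun f h1 h2 => k3 f (by simpa using h1) h2)
  by_cases k4 : ∀ f, f ∉ Z → f ∈ Y → Rh E {f} < m
  · exact compY (quad H1 hlow hm hpar hM1 hG.compl Yᶜ
      (fun f h1 h2 => k4 f (by simpa using h1) (by simpa using h2)))
  push Not at k1 k2 k3 k4
  obtain ⟨f1, f1Z, f1Y, f1m⟩ := k1
  obtain ⟨f2, f2Z, f2Y, f2m⟩ := k2
  obtain ⟨f3, f3Z, f3Y, f3m⟩ := k3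
  obtain ⟨f4, f4Z, f4Y, f4m⟩ := k4
  have hh : ∀ (p q : V) (X : Finset V), p ∈ X → q ∉ X → m ≤ Rh E {p} → m ≤ Rh E {q} → Rh E Z ≤ Rh E X := by
    intro p q X hp hq h1 h2
    have hpq : p ≠ q := by rintro rfl; exact hq hp
    have h3 := H1 p q hpq
    have h4 : rh E p q ≤ Rh E X := le_Rs hp hq
    unfold rh at h4
    omega
  have r1 := hh f2 f1 (Z ∩ Y) (by simp [*]) (by simp [*]) f2m f1m
  have r2 := hh f1 f2 (Z \ Y) (by simp [*]) (by simp [*]) f1m f2m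
  have r3 := hh f4 f3 (Y \ Z) (by simp [*]) (by simp [*]) f4m f3m
  have r4 := hh f4 f3 (Z ∪ Y) (by simp [*]) (by simp [*]) f4m f3m
  have both : Rh E Z + Rh E Y ≤ Rh E (Z ∩ Y) + Rh E (Z ∪ Y) ∧
      Rh E Z + Rh E Y ≤ Rh E (Z \ Y) + Rh E (Y \ Z) := by
    by_cases hq : Rh E Y ≤ Rh E Z
    · omega
    · obtain ⟨x, hx, y, hy, e⟩ := exists_Rs_pos (rh E) (X := Y) (by unfold Rh at hq; omega)
      have e' : Rh E Y = rh E x y := e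
      have key : ∀ (X : Finset V), (x ∈ X ∧ y ∉ X ∨ x ∉ X ∧ y ∈ X) → rh E x y ≤ Rh E X := by
        rintro X (⟨h1, h2⟩ | ⟨h1, h2⟩)
        · exact le_Rs h1 h2
        · rw [rh_comm]; exact le_Rs h2 h1
      have kZ := key Z
      have g1 := key (Z ∩ Y)
      have g2 := key (Z ∪ Y)
      have g3 := key (Z \ Y)
      have g4 := key (Y \ Z)
      simp only [mem_inter, mem_union, mem_sdiff, hx, hy] at g1 g2 g3 g4
      by_cases hxZ : x ∈ Z <;> by_cases hyZ : y ∈ Z <;> simp [hxZ, hyZ] at kZ g1 g2 g3 g4 <;> omega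
  obtain ⟨e, heM, he1⟩ := exists_of_d_pos (E := M) (X := Z) (by omega)
  obtain ⟨M', rfl⟩ := Multiset.exists_cons_of_mem heM
  have hM' : ∀ e ∈ M', ind Z e = 0 := by
    intro e' he'
    have := d_pos_of_mem he' Z
    rw [d_cons] at hMZ
    omega
  obtain ⟨p, q, hp, hq, rfl⟩ := ind_one_iff.1 he1
  by_cases hdiag : p ∉ Y ∧ q ∈ Y
  · have a1 := hfe' (Z \ Y) (Or.inl sdiff_subset)
    have a2 := hfe' (Y \ Z) (Or.inr (Or.inl (by intro x; simp)))
    have a3 := d_posi E Z Y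
    have a4 : d (s(p,q) ::ₘ M') Y + d (s(p,q) ::ₘ M') Z ≤ d (s(p,q) ::ₘ M') (Z \ Y) + d (s(p,q) ::ₘ M') (Y \ Z) := by
      apply d_le2
      intro e he
      rw [Multiset.mem_cons] at he
      rcases he with rfl | he
      · simp only [ind_mk, mem_sdiff] at *; grind
      · have := hM' e he
        induction e using Sym2.ind with | _ a b =>
          simp only [ind_mk, mem_sdiff] at *; grind
    omega
  · have a1 := hfe' (Z ∩ Y) (Or.inl inter_subset_left)
    have a2 := hfe' (Z ∪ Y) (Or.inr (Or.inr (Or.inl subset_union_left)))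
    have a3 := d_submod E Z Y
    have a4 : d (s(p,q) ::ₘ M') Y + d (s(p,q) ::ₘ M') Z ≤ d (s(p,q) ::ₘ M') (Z ∩ Y) + d (s(p,q) ::ₘ M') (Z ∪ Y) := by
      apply d_le2
      intro e he
      rw [Multiset.mem_cons] at he
      rcases he with rfl | he
      · simp only [ind_mk, mem_inter, mem_union] at *; grind
      · have := hM' e he
        induction e using Sym2.ind with | _ a b =>
          simp only [ind_mk, mem_inter, mem_union] at *; grind
    omega

theorem step (E : Multiset (Sym2 V)) (ih : IH V E.card) : ∃ M, Feas E M := by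
  by_contra hcon
  have nt : NT E := by
    intro X h1 h2
    by_contra hc
    exact hcon (step1 E ih X h1 h2 (le_antisymm (by omega) (Rh_le _ _)))
  have ET : ∀ e ∈ E, ∃ v, Tight E v ∧ ind {v} e = 1 := by
    intro e he
    exact (step2 E ih nt e he).resolve_left hcon
  obtain ⟨m, H1, hm⟩ := exists_m nt
  have hlow : ∀ a b, s(a, b) ∈ E → Rh E {a} < m → Rh E {b} < m → False :=
    fun a b h1 h2 h3 => hcon (step3A E ih nt ET H1 h1 h2 h3)
  rcases hm with ⟨a, b, hab, h1, h2, h3, h4⟩ | hm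
  · exact hcon (step3B E ih H1 hlow h4 hab h1 h2 h3)
  · have : E = 0 := by
      apply Multiset.eq_zero_of_forall_notMem
      intro e he
      induction e using Sym2.ind with | _ a b =>
        exact hlow a b he (hm a) (hm b)
    subst this
    refine hcon ⟨0, fun v => rfl, fun X => ?_⟩
    have := Rh_le (0 : Multiset (Sym2 V)) X
    rw [d_zero] at *
    omega

theorem main_feas (n : ℕ) : ∀ (W : Type u) [Fintype W] [DecidableEq W] (F : Multiset (Sym2 W)),
    Fintype.card W + F.card = n → ∃ M, Feas F M := by
  induction n using Nat.strong_induction_on with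
  | _ n ih =>
    intro W _ _ F hF
    apply step
    intro W' _ _ F' hF'
    exact ih _ (by omega) W' F' rfl

end main
end NW

namespace NW
open Finset

section arcs
variable {V : Type u} [DecidableEq V]

def o (X : Finset V) (p : V × V) : ℕ := if p.1 ∈ X ∧ p.2 ∉ X then 1 else 0
def i (X : Finset V) (p : V × V) : ℕ := if p.1 ∉ X ∧ p.2 ∈ X then 1 else 0

def mo (A : Multiset (V × V)) (X : Finset V) : ℕ := (A.map (o X)).sum
def mi (A : Multiset (V × V)) (X : Finset V) : ℕ := (A.map (i X)).sum

def mk (p : V × V) : Sym2 V := s(p.1, p.2)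

theorem mo_cons (p : V × V) (A : Multiset (V × V)) (X : Finset V) : mo (p ::ₘ A) X = o X p + mo A X := by
  simp [mo]
theorem mi_cons (p : V × V) (A : Multiset (V × V)) (X : Finset V) : mi (p ::ₘ A) X = i X p + mi A X := by
  simp [mi]
theorem mo_add (A B : Multiset (V × V)) (X : Finset V) : mo (A + B) X = mo A X + mo B X := by
  simp [mo]
theorem mi_add (A B : Multiset (V × V)) (X : Finset V) : mi (A + B) X = mi A X + mi B X := by
  simp [mi]

theorem d_eq_mo_mi (A : Multiset (V × V)) (X : Finset V) : d (A.map mk) X = mo A X + mi A X := by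
  induction A using Multiset.induction with
  | empty => rfl
  | cons p A ih =>
    rw [Multiset.map_cons, d_cons, mo_cons, mi_cons, ih]
    have : ind X (mk p) = o X p + i X p := by
      simp only [mk, ind_mk, o, i]; grind
    omega

theorem euler (n : ℕ) : ∀ E : Multiset (Sym2 V), E.card ≤ n → (∀ v, d E {v} % 2 = 0) →
    ∃ A : Multiset (V × V), A.map mk = E ∧ ∀ X, mo A X = mi A X := by
  induction n with
  | zero =>
    intro E hE _
    have : E = 0 := by simpa using hE
    subst this
    exact ⟨0, rfl, fun _ => rfl⟩
  | succ n ih =>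
    intro E hE hev
    by_cases h : ∃ v, d E {v} ≠ 0
    · obtain ⟨v, hv⟩ := h
      have := hev v
      obtain ⟨a, b, F, ha, hb, rfl⟩ := two_edges (E := E) (v := v) (by omega)
      obtain ⟨A, hA, hbal⟩ := ih (s(a, b) ::ₘ F) (by simp at hE ⊢; omega) (by
        intro w
        have h1 := hev w
        simp only [d_cons] at h1 ⊢
        have := (ind_split {w} v a b).2
        omega)
      have hmem : s(a, b) ∈ A.map mk := by rw [hA]; simp
      obtain ⟨p, hp, hpe⟩ := Multiset.mem_map.1 hmem
      obtain ⟨A', rfl⟩ := Multiset.exists_cons_of_mem hp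
      rw [Multiset.map_cons, hpe, Multiset.cons_inj_right] at hA
      refine ⟨(p.1, v) ::ₘ (v, p.2) ::ₘ A', ?_, ?_⟩
      · rw [Multiset.map_cons, Multiset.map_cons, hA]
        unfold mk at hpe ⊢
        rw [Sym2.eq_iff] at hpe
        rcases hpe with ⟨h1, h2⟩ | ⟨h1, h2⟩
        · rw [h1, h2, Sym2.eq_swap (a := a)]
        · rw [h1, h2, Sym2.eq_swap (a := b), Multiset.cons_swap]
      · intro X
        have h1 := hbal X
        simp only [mo_cons, mi_cons] at h1 ⊢
        have : o X (p.1, v) + o X (v, p.2) + i X p = i X (p.1, v) + i X (v, p.2) + o X p := by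
          simp only [o, i]; grind
        omega
    · push Not at h
      refine ⟨E.map Quot.out, ?_, ?_⟩
      · rw [Multiset.map_map]
        conv_rhs => rw [← Multiset.map_id E]
        apply Multiset.map_congr rfl
        intro e _
        exact Quot.out_eq e
      · intro X
        unfold mo mi
        rw [Multiset.map_map, Multiset.map_map]
        congr 1
        apply Multiset.map_congr rfl
        intro e he
        have h1 : s((Quot.out e).1, (Quot.out e).2) = e := Quot.out_eq e
        have h2 := d_pos_of_mem he {(Quot.out e).1}
        rw [h, ← h1, ind_mk] at h2
        have h3 : (Quot.out e).1 = (Quot.out e).2 := by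
          rw [h1] at h2
          simp only [mem_singleton] at h2
          grind
        simp only [Function.comp, o, i]
        rw [h3]
        grind

theorem split_map {α β : Type*} (f : α → β) (E : Multiset β) : ∀ (M : Multiset β) (A : Multiset α),
    A.map f = E + M → ∃ A1 A2, A = A1 + A2 ∧ A1.map f = E ∧ A2.map f = M := by
  induction E using Multiset.induction with
  | empty => intro M A h; exact ⟨0, A, by simp, rfl, by simpa using h⟩
  | cons e E ih =>
    intro M A h
    have : e ∈ A.map f := by rw [h]; simp
    obtain ⟨p, hp, rfl⟩ := Multiset.mem_map.1 this
    obtain ⟨A', rfl⟩ := Multiset.exists_cons_of_mem hp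
    rw [Multiset.map_cons, Multiset.cons_add, Multiset.cons_inj_right] at h
    obtain ⟨A1, A2, rfl, h1, h2⟩ := ih M A' h
    exact ⟨p ::ₘ A1, A2, by simp, by simp [h1], h2⟩

/-- out-degree -/
def ou (A : Finset (V × V)) (X : Finset V) : ℕ := ∑ p ∈ A, o X p
def inn (A : Finset (V × V)) (X : Finset V) : ℕ := ∑ p ∈ A, i X p

theorem walk_cons {D : V → V → Prop} {w t v : V} {l : List (V × V)} (h : D w t)
    (hl : IsDiWalk D t v l) : IsDiWalk D w v ((w, t) :: l) := by
  obtain ⟨h1, h2, h3⟩ := hl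
  refine ⟨?_, ?_, ?_⟩
  · intro a ha
    rw [List.mem_cons] at ha
    rcases ha with rfl | ha
    · exact h
    · exact h1 a ha
  · rcases h3 with ⟨rfl, _⟩ | ⟨h3, _⟩
    · exact List.isChain_singleton _
    · refine List.isChain_cons.2 ⟨?_, h2⟩
      intro b hb
      rw [Option.mem_def] at hb
      rw [hb] at h3
      simpa using h3.symm
  · right
    refine ⟨rfl, ?_⟩
    rcases h3 with ⟨rfl, h4⟩ | ⟨_, h4⟩
    · simp [h4]
    · cases l with
      | nil => simp at h4
      | cons b l => simpa using h4

theorem IsDiWalk_mono {D D' : V → V → Prop} (h : ∀ a b, D a b → D' a b) {w v : V} {l : List (V × V)}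
    (hl : IsDiWalk D w v l) : IsDiWalk D' w v l :=
  ⟨fun a ha => h _ _ (hl.1 a ha), hl.2⟩

theorem tokens (N n : ℕ) (v : V) : ∀ (A : Finset (V × V)) (a : Fin n → V), A.card = N →
    (∀ X, v ∉ X → inn A X + ∑ j, (if a j ∈ X then 1 else 0) ≤ ou A X) →
    ∃ f : Fin n → List (V × V), (∀ j, IsDiWalk (fun x y => (x, y) ∈ A) (a j) v (f j)) ∧
      ∀ j k, j ≠ k → ∀ p, p ∈ f j → p ∉ f k := by
  induction N with
  | zero =>
    intro A a hA h
    have : A = ∅ := by simpa using hA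
    subst this
    refine ⟨fun _ => [], fun j => ⟨by simp, List.isChain_nil, Or.inl ⟨rfl, ?_⟩⟩, by simp⟩
    by_contra hc
    have h1 := h {a j} (by simpa using fun h => hc h.symm)
    have h2 := Finset.single_le_sum (f := fun k => if a k ∈ ({a j} : Finset V) then 1 else 0) (fun _ _ => Nat.zero_le _) (mem_univ j)
    simp only [mem_singleton, if_true] at h1 h2
    simp only [ou, inn, sum_empty] at h1
    omega
  | succ N ih =>
    intro A a hA h
    by_cases hall : ∀ j, a j = v
    · exact ⟨fun _ => [], fun j => ⟨by simp, List.isChain_nil, Or.inl ⟨rfl, hall j⟩⟩, by simp⟩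
    push Not at hall
    obtain ⟨j, hj⟩ := hall
    have h1 := h {a j} (by simpa using fun h => hj h.symm)
    have h2 := Finset.single_le_sum (f := fun k => if a k ∈ ({a j} : Finset V) then 1 else 0) (fun _ _ => Nat.zero_le _) (mem_univ j)
    simp only [mem_singleton, if_true] at h2
    obtain ⟨p, hp, hp1⟩ : ∃ p ∈ A, o {a j} p ≠ 0 := by
      apply Finset.exists_ne_zero_of_sum_ne_zero
      simp only [mem_singleton] at h1
      unfold ou at h1
      omega
    obtain ⟨w, t⟩ := p
    have hw : w = a j ∧ t ≠ a j := by
      simp only [o, mem_singleton] at hp1; grind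
    obtain ⟨rfl, ht⟩ := hw
    obtain ⟨f, hf1, hf2⟩ := ih (A.erase (a j, t)) (Function.update a j t)
      (by rw [card_erase_of_mem hp]; omega) (by
        intro X hX
        have g1 := h X hX
        unfold ou inn at g1 ⊢
        rw [← add_sum_erase A _ hp, ← add_sum_erase A _ hp] at g1
        rw [← add_sum_erase univ _ (mem_univ j)] at g1 ⊢
        have g2 : ∑ x ∈ univ.erase j, (if Function.update a j t x ∈ X then 1 else 0) =
            ∑ x ∈ univ.erase j, (if a x ∈ X then 1 else 0) := by
          apply sum_congr rfl
          intro x hx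
          rw [Function.update_of_ne (mem_erase.1 hx).1]
        rw [g2, Function.update_self]
        simp only [o, i] at g1 ⊢
        grind)
    refine ⟨Function.update f j ((a j, t) :: f j), ?_, ?_⟩
    · intro k
      by_cases hk : k = j
      · subst hk
        rw [Function.update_self]
        have := hf1 k
        rw [Function.update_self] at this
        exact walk_cons hp (IsDiWalk_mono (fun x y h => mem_of_mem_erase h) this)
      · rw [Function.update_of_ne hk]
        have := hf1 k
        rw [Function.update_of_ne hk] at this
        exact IsDiWalk_mono (fun x y h => mem_of_mem_erase h) this
    · have hno : ∀ k, (a j, t) ∉ f k := by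
        intro k hk
        have := (hf1 k).1 _ hk
        simp at this
      intro k l hkl p hpk
      by_cases hk : k = j
      · subst hk
        rw [Function.update_self, List.mem_cons] at hpk
        rw [Function.update_of_ne hkl.symm]
        rcases hpk with rfl | hpk
        · exact hno l
        · exact hf2 k l hkl p hpk
      · rw [Function.update_of_ne hk] at hpk
        by_cases hl : l = j
        · subst hl
          rw [Function.update_self, List.mem_cons]
          rintro (rfl | hpl)
          · exact hno k hpk
          · exact hf2 k l hkl p hpk hpl
        · rw [Function.update_of_ne hl]
          exact hf2 k l hkl p hpk

theorem ou_sum (A : Finset (V × V)) (X : Finset V) :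
    ou A X + ∑ w ∈ X, inn A {w} = inn A X + ∑ w ∈ X, ou A {w} := by
  induction X using Finset.induction with
  | empty => simp [ou, inn, o, i]
  | insert w X hw ih =>
    rw [sum_insert hw, sum_insert hw]
    have : ou A (insert w X) + inn A X + inn A {w} = inn A (insert w X) + ou A X + ou A {w} := by
      unfold ou inn
      simp only [← sum_add_distrib]
      apply sum_congr rfl
      rintro ⟨a, b⟩ _
      simp only [o, i, mem_insert, mem_singleton]
      grind
    omega

theorem menger [Fintype V] (A0 : Finset (V × V)) (u v : V) (huv : u ≠ v) (n : ℕ)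
    (h0 : ∀ X, u ∈ X → v ∉ X → n ≤ ou A0 X) :
    ∃ f : Fin n → List (V × V), (∀ j, IsDiWalk (fun x y => (x, y) ∈ A0) u v (f j)) ∧
      ∀ j k, j ≠ k → ∀ p, p ∈ f j → p ∉ f k := by
  classical
  obtain ⟨A, hA, hmin⟩ := Finset.exists_min_image
    (A0.powerset.filter (fun A => ∀ X, u ∈ X → v ∉ X → n ≤ ou A X)) Finset.card ⟨A0, by simpa using h0⟩
  simp only [mem_filter, mem_powerset] at hA hmin
  obtain ⟨hsub, hcut⟩ := hA
  have htight : ∀ p ∈ A, ∃ X, u ∈ X ∧ v ∉ X ∧ ou A X = n ∧ p.1 ∈ X ∧ p.2 ∉ X := by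
    intro p hp
    have : ¬ ∀ X, u ∈ X → v ∉ X → n ≤ ou (A.erase p) X := by
      intro hc
      have := hmin (A.erase p) ⟨(erase_subset _ _).trans hsub, hc⟩
      have := card_erase_lt_of_mem hp
      omega
    push Not at this
    obtain ⟨X, h1, h2, h3⟩ := this
    have h4 := hcut X h1 h2
    have h5 : ou A X = o X p + ou (A.erase p) X := (add_sum_erase A _ hp).symm
    have h6 : o X p ≤ 1 := by unfold o; split_ifs <;> omega
    have h7 : o X p = 1 := by omega
    refine ⟨X, h1, h2, by omega, ?_⟩
    unfold o at h7
    by_contra hc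
    rw [if_neg hc] at h7
    omega
  have hin : ∀ w, w ≠ v → w ≠ u → inn A {w} ≤ ou A {w} := by
    intro w hwv hwu
    by_cases hz : inn A {w} = 0
    · omega
    obtain ⟨p, hp, hp1⟩ : ∃ p ∈ A, i {w} p ≠ 0 := Finset.exists_ne_zero_of_sum_ne_zero hz
    have hp2 : p.2 = w := by simp only [i, mem_singleton] at hp1; grind
    obtain ⟨X, hX⟩ := htight p hp
    obtain ⟨T, hT, hTmax⟩ := Finset.exists_max_image
      (univ.filter (fun T : Finset V => u ∈ T ∧ v ∉ T ∧ ou A T = n ∧ w ∉ T)) Finset.card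
      ⟨X, by simp only [mem_filter, mem_univ, true_and]; rw [← hp2]; exact ⟨hX.1, hX.2.1, hX.2.2.1, hX.2.2.2.2⟩⟩
    simp only [mem_filter, mem_univ, true_and] at hT hTmax
    obtain ⟨hTu, hTv, hTn, hTw⟩ := hT
    have hfrom : ∀ q ∈ A, q.2 = w → q.1 ∈ T := by
      intro q hq hqw
      obtain ⟨Y, y1, y2, y3, y4, y5⟩ := htight q hq
      have s1 := hcut (T ∩ Y) (by simp [*]) (by simp [*])
      have s2 := hcut (T ∪ Y) (by simp [*]) (by simp [*])
      have s3 : ou A (T ∩ Y) + ou A (T ∪ Y) ≤ ou A T + ou A Y := by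
        unfold ou
        rw [← sum_add_distrib, ← sum_add_distrib]
        apply sum_le_sum
        rintro ⟨a, b⟩ _
        simp only [o, mem_inter, mem_union]
        grind
      have s4 := hTmax (T ∪ Y) ⟨by simp [*], by simp [*], by omega, by rw [hqw] at y5; simp [*]⟩
      have s5 : T = T ∪ Y := eq_of_subset_of_card_le subset_union_left s4
      rw [s5]; simp [y4]
    have s1 := hcut (insert w T) (by simp [*]) (by simp [hTv, hwv.symm])
    have s2 : ou A (insert w T) + inn A {w} ≤ ou A T + ou A {w} := by
      unfold ou inn
      rw [← sum_add_distrib, ← sum_add_distrib]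
      apply sum_le_sum
      rintro ⟨a, b⟩ hab
      have := hfrom _ hab
      simp only [o, i, mem_insert, mem_singleton] at *
      grind
    omega
  have hinu : inn A {u} = 0 := by
    by_contra hz
    obtain ⟨p, hp, hp1⟩ : ∃ p ∈ A, i {u} p ≠ 0 := Finset.exists_ne_zero_of_sum_ne_zero hz
    have hp2 : p.2 = u := by simp only [i, mem_singleton] at hp1; grind
    obtain ⟨X, hX⟩ := htight p hp
    rw [hp2] at hX
    exact hX.2.2.2.2 hX.1
  have hou : n ≤ ou A {u} := hcut _ (by simp) (by simpa using huv.symm)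
  obtain ⟨f, hf1, hf2⟩ := tokens _ n v A (fun _ => u) rfl (by
    intro X hX
    have h1 := ou_sum A X
    by_cases hu : u ∈ X
    · simp only [hu, if_true, sum_const, card_univ, Fintype.card_fin, smul_eq_mul, mul_one]
      rw [← add_sum_erase X _ hu, ← add_sum_erase X _ hu] at h1
      have h2 : ∑ w ∈ X.erase u, inn A {w} ≤ ∑ w ∈ X.erase u, ou A {w} := by
        apply sum_le_sum
        intro w hw
        rw [mem_erase] at hw
        exact hin w (by rintro rfl; exact hX hw.2) hw.1
      omega
    · simp only [hu, if_false, sum_const_zero]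
      have h2 : ∑ w ∈ X, inn A {w} ≤ ∑ w ∈ X, ou A {w} := by
        apply sum_le_sum
        intro w hw
        exact hin w (by rintro rfl; exact hX hw) (by rintro rfl; exact hu hw)
      omega)
  exact ⟨f, fun j => IsDiWalk_mono (fun x y h => hsub h) (hf1 j), hf2⟩

end arcs

theorem flow_cut {V : Type u} [Fintype V] [DecidableEq V] (H : SimpleGraph V) [Fintype H.edgeSet]
    {x y : V} {n : ℕ}
    (h : HasFlow H x y n) (X : Finset V) (hx : x ∈ X) (hy : y ∉ X) : n ≤ d H.edgeFinset.val X := by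
  obtain ⟨f, hf⟩ := h
  have : ∀ j, ∃ e ∈ (f j).edges, ind X e = 1 := by
    intro j
    obtain ⟨dd, h1, h2, h3⟩ := (f j).exists_boundary_dart (X : Set V) (by simpa using hx) (by simpa using hy)
    refine ⟨dd.edge, List.mem_map_of_mem h1, ?_⟩
    rw [ind_one_iff]
    exact ⟨dd.fst, dd.snd, by simpa using h2, by simpa using h3, rfl⟩
  choose g hg1 hg2 using this
  have hinj : Function.Injective g := by
    intro j k hjk
    by_contra hne
    exact hf j k hne (g j) (hg1 j) (hjk ▸ hg1 k)
  have h1 : d H.edgeFinset.val X = ∑ e ∈ H.edgeFinset, ind X e := rfl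
  have h2 : ∑ e ∈ univ.image g, ind X e ≤ ∑ e ∈ H.edgeFinset, ind X e := by
    apply sum_le_sum_of_subset
    intro e he
    obtain ⟨j, _, rfl⟩ := mem_image.1 he
    rw [SimpleGraph.mem_edgeFinset]
    exact (f j).edges_subset_edgeSet (hg1 j)
  rw [sum_image (fun a _ b _ h => hinj h)] at h2
  simp [hg2] at h2
  rw [h1]; exact h2

theorem final {V : Type u} [Fintype V] (H : SimpleGraph V) (r : V → V → ℕ)
    (hr : ∀ u v : V, HasFlow H u v (r u v + r v u)) :
    ∃ D : V → V → Prop, IsOrientation H D ∧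
      ∀ u v : V, HasDiFlow D u v ((r u v + r v u) / 2) := by
  classical
  obtain ⟨M, hM1, hM2⟩ := main_feas _ V H.edgeFinset.val rfl
  obtain ⟨A, hA, hbal⟩ := euler _ (H.edgeFinset.val + M) le_rfl (by
    intro v
    rw [d_add]
    have := hM1 v
    omega)
  obtain ⟨A1, A2, rfl, h1, h2⟩ := split_map mk _ _ _ hA
  have hnd : (A1.map mk).Nodup := by rw [h1]; exact H.edgeFinset.nodup
  have hnd1 : A1.Nodup := Multiset.Nodup.of_map _ hnd
  refine ⟨fun u v => (u, v) ∈ A1, ?_, ?_⟩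
  · intro u v
    have hmem : H.Adj u v ↔ s(u, v) ∈ A1.map mk := by
      rw [h1, Finset.mem_val, SimpleGraph.mem_edgeFinset, SimpleGraph.mem_edgeSet]
    refine ⟨?_, ?_⟩
    · rw [hmem, Multiset.mem_map]
      constructor
      · rintro ⟨⟨a, b⟩, hp, he⟩
        simp only [mk, Sym2.eq_iff] at he
        rcases he with ⟨rfl, rfl⟩ | ⟨rfl, rfl⟩
        · left; exact hp
        · right; exact hp
      · rintro (h | h)
        · exact ⟨_, h, rfl⟩
        · exact ⟨_, h, Sym2.eq_swap⟩
    · rintro ⟨ha, hb⟩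
      have h3 : (u, v) = (v, u) := Multiset.inj_on_of_nodup_map hnd _ ha _ hb Sym2.eq_swap
      have h4 : u = v := congrArg Prod.fst h3
      have h5 : H.Adj u v := hmem.2 (Multiset.mem_map.2 ⟨_, ha, rfl⟩)
      exact h5.ne h4
  · intro u v
    by_cases huv : u = v
    · exact ⟨fun _ => [], fun _ => ⟨by simp, List.isChain_nil, Or.inl ⟨rfl, huv⟩⟩, by simp⟩
    · have hcut : ∀ X, u ∈ X → v ∉ X → (r u v + r v u) / 2 ≤ ou ⟨A1, hnd1⟩ X := by
        intro X hu hv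
        have e0 : ou ⟨A1, hnd1⟩ X = mo A1 X := rfl
        rw [e0]
        have e1 := hbal X
        rw [mo_add, mi_add] at e1
        have e2 := d_eq_mo_mi A1 X
        have e3 := d_eq_mo_mi A2 X
        rw [h1] at e2
        rw [h2] at e3
        have e4 := hM2 X
        have e5 : rh H.edgeFinset.val u v ≤ Rh H.edgeFinset.val X := le_Rs hu hv
        obtain ⟨Y, hY1, hY2, hY3⟩ := lam_att H.edgeFinset.val huv
        have e6 := flow_cut H (hr u v) Y hY1 hY2
        unfold rh at e5
        omega
      obtain ⟨f, hf1, hf2⟩ := menger ⟨A1, hnd1⟩ u v huv _ hcut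
      exact ⟨f, hf1, hf2⟩

end NW

/-- if `λ_H(u,v) ≥ r(u,v) + r(v,u)` for all `u,v`, then `H` has an
orientation `D` with `λ_D(u,v) ≥ ⌊(r(u,v) + r(v,u))/2⌋` for all ordered pairs. -/
theorem orientation_satisfying_half_demands
    {V : Type*} [Fintype V] (H : SimpleGraph V) (r : V → V → ℕ)
    (hr : ∀ u v : V, HasFlow H u v (r u v + r v u)) :
    ∃ D : V → V → Prop, IsOrientation H D ∧
      ∀ u v : V, HasDiFlow D u v ((r u v + r v u) / 2) := by
  exact NW.final H r hr
end
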